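/- arXiv:2410.14908 — 3 statements merged into one kernel-verified Lean document; each statement's English description precedes it below -/
import Mathlib

section
/- Let (A, V, C, R1, R2, R3, E) be two-sided crossed product data over a field k. Then the multiplication on A⊗V⊗C defined by (a⊗v⊗c)(a'⊗v'⊗c') = a(a'_{R3})_{R1} E_A(v_{R1}, v'_{R2}) ⊗ E_V(v_{R1}, v'_{R2}) ⊗ E_C(v_{R1}, v'_{R2})(c_{R3})_{R2} c' (in Sweedler-type notation) is associative with unit 1_A⊗1_V⊗1_C. The resulting algebra is denoted A ⋊ V ⋉ C and called the two-sided crossed product afforded by R1, R2, R3, E. -/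
open TensorProduct LinearMap

set_option maxHeartbeats 1000000
set_option synthInstance.maxHeartbeats 400000

noncomputable section

namespace TwoSidedCP

variable (k : Type*) [Field k]

/-- The associator as a linear map. -/
abbrev α (X Y Z : Type*) [AddCommGroup X] [Module k X] [AddCommGroup Y] [Module k Y]
    [AddCommGroup Z] [Module k Z] :
    (X ⊗[k] Y) ⊗[k] Z →ₗ[k] X ⊗[k] (Y ⊗[k] Z) :=
  (TensorProduct.assoc k X Y Z).toLinearMap

/-- The inverse associator as a linear map. -/
abbrev α' (X Y Z : Type*) [AddCommGroup X] [Module k X] [AddCommGroup Y] [Module k Y]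
    [AddCommGroup Z] [Module k Z] :
    X ⊗[k] (Y ⊗[k] Z) →ₗ[k] (X ⊗[k] Y) ⊗[k] Z :=
  (TensorProduct.assoc k X Y Z).symm.toLinearMap

/-- Multiplication `A ⊗ (A ⊗ V) → A ⊗ V` of the two `A`-factors. -/
def mulAV (A : Type*) [Ring A] [Algebra k A] (V : Type*) [AddCommGroup V] [Module k V] :
    A ⊗[k] (A ⊗[k] V) →ₗ[k] A ⊗[k] V :=
  rTensor V (mul' k A) ∘ₗ α' k A A V

/-- Multiplication `(X ⊗ C) ⊗ C → X ⊗ C` of the two `C`-factors. -/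
def mulXC (X : Type*) [AddCommGroup X] [Module k X] (C : Type*) [Ring C] [Algebra k C] :
    (X ⊗[k] C) ⊗[k] C →ₗ[k] X ⊗[k] C :=
  lTensor X (mul' k C) ∘ₗ α k X C C

section TwistingMaps
variable (A B : Type*) [Ring A] [Algebra k A] [Ring B] [Algebra k B]

/-- `R : B ⊗ A → A ⊗ B` is a twisting map between the algebras `A` and `B`:
  in Sweedler notation, `R(b ⊗ 1) = 1 ⊗ b`, `R(1 ⊗ a) = a ⊗ 1`,
  `(aa')_R ⊗ b_R = a_R a'_r ⊗ b_{R_r}` and `a_R ⊗ (bb')_R = a_{R_r} ⊗ b_r b'_R`. -/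
structure IsTwistingMap (R : B ⊗[k] A →ₗ[k] A ⊗[k] B) : Prop where
  unit_left : ∀ a : A, R ((1 : B) ⊗ₜ[k] a) = a ⊗ₜ[k] (1 : B)
  unit_right : ∀ b : B, R (b ⊗ₜ[k] (1 : A)) = (1 : A) ⊗ₜ[k] b
  mul_left : R ∘ₗ lTensor B (mul' k A) ∘ₗ α k B A A
      = rTensor B (mul' k A) ∘ₗ α' k A A B ∘ₗ lTensor A R ∘ₗ α k A B A ∘ₗ rTensor A R
  mul_right : R ∘ₗ rTensor A (mul' k B)
      = lTensor A (mul' k B) ∘ₗ α k A B B ∘ₗ rTensor B R ∘ₗ α' k B A B ∘ₗ lTensor B R ∘ₗ α k B B A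

/-- The multiplication `(a ⊗ b)(a' ⊗ b') = a a'_R ⊗ b_R b'` of the twisted tensor
  product `A ⊗_R B`. -/
def twistMul (R : B ⊗[k] A →ₗ[k] A ⊗[k] B) :
    (A ⊗[k] B) ⊗[k] (A ⊗[k] B) →ₗ[k] A ⊗[k] B :=
  TensorProduct.map (mul' k A) (mul' k B) ∘ₗ α' k A A (B ⊗[k] B) ∘ₗ lTensor A (α k A B B)
    ∘ₗ lTensor A (rTensor B R) ∘ₗ lTensor A (α' k B A B) ∘ₗ α k A B (A ⊗[k] B)

end TwistingMaps

section Brzezinski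
variable (A V : Type*) [Ring A] [Algebra k A] [AddCommGroup V] [Module k V]

/-- The Brzeziński crossed product conditions (brz1)-(brz5) for the data `(A, V, R, σ)`. -/
structure IsBrzData (e : V) (R : V ⊗[k] A →ₗ[k] A ⊗[k] V)
    (σ : V ⊗[k] V →ₗ[k] A ⊗[k] V) : Prop where
  brz1a : ∀ a : A, R (e ⊗ₜ[k] a) = a ⊗ₜ[k] e
  brz1b : ∀ v : V, R (v ⊗ₜ[k] (1 : A)) = (1 : A) ⊗ₜ[k] v
  brz2a : ∀ v : V, σ (e ⊗ₜ[k] v) = (1 : A) ⊗ₜ[k] v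
  brz2b : ∀ v : V, σ (v ⊗ₜ[k] e) = (1 : A) ⊗ₜ[k] v
  brz3 : R ∘ₗ lTensor V (mul' k A) ∘ₗ α k V A A
      = rTensor V (mul' k A) ∘ₗ α' k A A V ∘ₗ lTensor A R ∘ₗ α k A V A ∘ₗ rTensor A R
  brz4 : rTensor V (mul' k A) ∘ₗ α' k A A V ∘ₗ lTensor A σ ∘ₗ α k A V V ∘ₗ rTensor V R
        ∘ₗ α' k V A V ∘ₗ lTensor V σ ∘ₗ α k V V V
      = rTensor V (mul' k A) ∘ₗ α' k A A V ∘ₗ lTensor A σ ∘ₗ α k A V V ∘ₗ rTensor V σ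
  brz5 : rTensor V (mul' k A) ∘ₗ α' k A A V ∘ₗ lTensor A σ ∘ₗ α k A V V ∘ₗ rTensor V R
        ∘ₗ α' k V A V ∘ₗ lTensor V R ∘ₗ α k V V A
      = rTensor V (mul' k A) ∘ₗ α' k A A V ∘ₗ lTensor A R ∘ₗ α k A V A ∘ₗ rTensor A σ

/-- The multiplication `μ_{A⊗V} = (μ₂ ⊗ id_V)∘(id_A ⊗ id_A ⊗ σ)∘(id_A ⊗ R ⊗ id_V)`
  of the Brzeziński crossed product `A ⊗_{R,σ} V`. -/
def brzMul (R : V ⊗[k] A →ₗ[k] A ⊗[k] V) (σ : V ⊗[k] V →ₗ[k] A ⊗[k] V) :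
    (A ⊗[k] V) ⊗[k] (A ⊗[k] V) →ₗ[k] A ⊗[k] V :=
  rTensor V (mul' k A) ∘ₗ α' k A A V ∘ₗ rTensor (A ⊗[k] V) (mul' k A)
    ∘ₗ α' k A A (A ⊗[k] V) ∘ₗ lTensor A (lTensor A σ) ∘ₗ lTensor A (α k A V V)
    ∘ₗ lTensor A (rTensor V R) ∘ₗ lTensor A (α' k V A V) ∘ₗ α k A V (A ⊗[k] V)

end Brzezinski

section Mirror
variable (W B : Type*) [AddCommGroup W] [Module k W] [AddCommGroup B] [Module k B]

/-- The mirror crossed product conditions (mir0)-(mir4) for the data `(W, B, P, ν)`,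
  where the multiplication of `B` is given by `mB` with unit `uB`. -/
structure IsMirrorData (mB : B ⊗[k] B →ₗ[k] B) (uB : B) (e : W)
    (P : B ⊗[k] W →ₗ[k] W ⊗[k] B) (ν : W ⊗[k] W →ₗ[k] W ⊗[k] B) : Prop where
  mir0a : ∀ b : B, P (b ⊗ₜ[k] e) = e ⊗ₜ[k] b
  mir0b : ∀ w : W, P (uB ⊗ₜ[k] w) = w ⊗ₜ[k] uB
  mir1a : ∀ w : W, ν (w ⊗ₜ[k] e) = w ⊗ₜ[k] uB
  mir1b : ∀ w : W, ν (e ⊗ₜ[k] w) = w ⊗ₜ[k] uB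
  mir2 : P ∘ₗ rTensor W mB
      = lTensor W mB ∘ₗ α k W B B ∘ₗ rTensor B P ∘ₗ α' k B W B ∘ₗ lTensor B P ∘ₗ α k B B W
  mir3 : lTensor W mB ∘ₗ α k W B B ∘ₗ rTensor B ν ∘ₗ α' k W W B ∘ₗ lTensor W P
        ∘ₗ α k W B W ∘ₗ rTensor W ν
      = lTensor W mB ∘ₗ α k W B B ∘ₗ rTensor B ν ∘ₗ α' k W W B ∘ₗ lTensor W ν ∘ₗ α k W W W
  mir4 : lTensor W mB ∘ₗ α k W B B ∘ₗ rTensor B ν ∘ₗ α' k W W B ∘ₗ lTensor W P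
        ∘ₗ α k W B W ∘ₗ rTensor W P
      = lTensor W mB ∘ₗ α k W B B ∘ₗ rTensor B P ∘ₗ α' k B W B ∘ₗ lTensor B ν ∘ₗ α k B W W

/-- The multiplication `μ_{W⊗B} = (id_W ⊗ μ₂)∘(ν ⊗ id_B ⊗ id_B)∘(id_W ⊗ P ⊗ id_B)`
  of the mirror crossed product `W ⊗̄_{P,ν} B`. -/
def mirMul (mB : B ⊗[k] B →ₗ[k] B) (P : B ⊗[k] W →ₗ[k] W ⊗[k] B)
    (ν : W ⊗[k] W →ₗ[k] W ⊗[k] B) :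
    (W ⊗[k] B) ⊗[k] (W ⊗[k] B) →ₗ[k] W ⊗[k] B :=
  lTensor W mB ∘ₗ lTensor W (lTensor B mB) ∘ₗ α k W B (B ⊗[k] B)
    ∘ₗ rTensor (B ⊗[k] B) ν ∘ₗ α' k W W (B ⊗[k] B) ∘ₗ lTensor W (α k W B B)
    ∘ₗ lTensor W (rTensor B P) ∘ₗ lTensor W (α' k B W B) ∘ₗ α k W B (W ⊗[k] B)

end Mirror

section TwoSided
variable (A V C : Type*) [Ring A] [Algebra k A] [AddCommGroup V] [Module k V]
  [Ring C] [Algebra k C]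

/-- auxiliary map: multiply the leftover `A`-factor and `C`-factor into `A ⊗ V ⊗ C`. -/
def tsTail : (A ⊗[k] ((A ⊗[k] V) ⊗[k] C)) ⊗[k] C →ₗ[k] (A ⊗[k] V) ⊗[k] C :=
  mulXC k (A ⊗[k] V) C ∘ₗ rTensor C (rTensor C (mulAV k A V) ∘ₗ α' k A (A ⊗[k] V) C)

/-- Two-sided crossed product data `(A, V, C, R1, R2, R3, E)`:
  conditions (i)-(v) of Theorem 2.1 of the paper. -/
structure IsTwoSidedData (e : V) (R1 : V ⊗[k] A →ₗ[k] A ⊗[k] V)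
    (R2 : C ⊗[k] V →ₗ[k] V ⊗[k] C) (R3 : C ⊗[k] A →ₗ[k] A ⊗[k] C)
    (E : V ⊗[k] V →ₗ[k] (A ⊗[k] V) ⊗[k] C) : Prop where
  twist : IsTwistingMap k A C R3
  r1a : ∀ a : A, R1 (e ⊗ₜ[k] a) = a ⊗ₜ[k] e
  r1b : ∀ v : V, R1 (v ⊗ₜ[k] (1 : A)) = (1 : A) ⊗ₜ[k] v
  r2a : ∀ c : C, R2 (c ⊗ₜ[k] e) = e ⊗ₜ[k] c
  r2b : ∀ v : V, R2 ((1 : C) ⊗ₜ[k] v) = v ⊗ₜ[k] (1 : C)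
  ea : ∀ v : V, E (e ⊗ₜ[k] v) = ((1 : A) ⊗ₜ[k] v) ⊗ₜ[k] (1 : C)
  eb : ∀ v : V, E (v ⊗ₜ[k] e) = ((1 : A) ⊗ₜ[k] v) ⊗ₜ[k] (1 : C)
  eq1 : R1 ∘ₗ lTensor V (mul' k A) ∘ₗ α k V A A
      = rTensor V (mul' k A) ∘ₗ α' k A A V ∘ₗ lTensor A R1 ∘ₗ α k A V A ∘ₗ rTensor A R1
  eq2 : R2 ∘ₗ rTensor V (mul' k C)
      = lTensor V (mul' k C) ∘ₗ α k V C C ∘ₗ rTensor C R2 ∘ₗ α' k C V C ∘ₗ lTensor C R2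
        ∘ₗ α k C C V
  eq3 : lTensor A R2 ∘ₗ α k A C V ∘ₗ rTensor V R3 ∘ₗ α' k C A V ∘ₗ lTensor C R1
      = α k A V C ∘ₗ rTensor C R1 ∘ₗ α' k V A C ∘ₗ lTensor V R3 ∘ₗ α k V C A
        ∘ₗ rTensor A R2 ∘ₗ α' k C V A
  eq4 : rTensor C (mulAV k A V) ∘ₗ α' k A (A ⊗[k] V) C ∘ₗ lTensor A E ∘ₗ α k A V V
        ∘ₗ rTensor V R1 ∘ₗ α' k V A V ∘ₗ lTensor V R1 ∘ₗ α k V V A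
      = rTensor C (mulAV k A V) ∘ₗ rTensor C (lTensor A R1) ∘ₗ rTensor C (α k A V A)
        ∘ₗ α' k (A ⊗[k] V) A C ∘ₗ lTensor (A ⊗[k] V) R3 ∘ₗ α k (A ⊗[k] V) C A ∘ₗ rTensor A E
  eq5 : mulXC k (A ⊗[k] V) C ∘ₗ rTensor C E ∘ₗ α' k V V C ∘ₗ lTensor V R2
        ∘ₗ α k V C V ∘ₗ rTensor V R2
      = mulXC k (A ⊗[k] V) C ∘ₗ rTensor C (α' k A V C) ∘ₗ rTensor C (lTensor A R2)
        ∘ₗ rTensor C (α k A C V) ∘ₗ rTensor C (rTensor V R3) ∘ₗ rTensor C (α' k C A V)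
        ∘ₗ α' k C (A ⊗[k] V) C ∘ₗ lTensor C E ∘ₗ α k C V V
  eq6 : tsTail k A V C ∘ₗ rTensor C (lTensor A E) ∘ₗ rTensor C (α k A V V)
        ∘ₗ rTensor C (rTensor V R1) ∘ₗ rTensor C (α' k V A V)
        ∘ₗ α' k V (A ⊗[k] V) C ∘ₗ lTensor V E ∘ₗ α k V V V
      = tsTail k A V C ∘ₗ rTensor C (lTensor A E) ∘ₗ rTensor C (α k A V V)
        ∘ₗ α' k (A ⊗[k] V) V C ∘ₗ lTensor (A ⊗[k] V) R2 ∘ₗ α k (A ⊗[k] V) C V ∘ₗ rTensor V E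

/-- The map `P = (id_A ⊗ R2)∘(R3 ⊗ id_V) : C ⊗ (A ⊗ V) → (A ⊗ V) ⊗ C`. -/
def tsP (R2 : C ⊗[k] V →ₗ[k] V ⊗[k] C) (R3 : C ⊗[k] A →ₗ[k] A ⊗[k] C) :
    C ⊗[k] (A ⊗[k] V) →ₗ[k] (A ⊗[k] V) ⊗[k] C :=
  α' k A V C ∘ₗ lTensor A R2 ∘ₗ α k A C V ∘ₗ rTensor V R3 ∘ₗ α' k C A V

/-- The map `ν = (μ_A ⊗ id_V ⊗ id_C)∘(μ_A ⊗ E)∘(id_A ⊗ R1 ⊗ id_V)`,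
  `ν((a ⊗ v) ⊗ (a' ⊗ v')) = (a a'_{R1} E_A(v_{R1}, v') ⊗ E_V(v_{R1}, v')) ⊗ E_C(v_{R1}, v')`. -/
def tsNu (R1 : V ⊗[k] A →ₗ[k] A ⊗[k] V) (E : V ⊗[k] V →ₗ[k] (A ⊗[k] V) ⊗[k] C) :
    (A ⊗[k] V) ⊗[k] (A ⊗[k] V) →ₗ[k] (A ⊗[k] V) ⊗[k] C :=
  rTensor C (mulAV k A V) ∘ₗ α' k A (A ⊗[k] V) C ∘ₗ lTensor A (rTensor C (mulAV k A V))
    ∘ₗ lTensor A (α' k A (A ⊗[k] V) C) ∘ₗ lTensor A (lTensor A E) ∘ₗ lTensor A (α k A V V)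
    ∘ₗ lTensor A (rTensor V R1) ∘ₗ lTensor A (α' k V A V) ∘ₗ α k A V (A ⊗[k] V)

/-- The map `R = (R1 ⊗ id_C)∘(id_V ⊗ R3) : (V ⊗ C) ⊗ A → A ⊗ (V ⊗ C)`. -/
def tsR (R1 : V ⊗[k] A →ₗ[k] A ⊗[k] V) (R3 : C ⊗[k] A →ₗ[k] A ⊗[k] C) :
    (V ⊗[k] C) ⊗[k] A →ₗ[k] A ⊗[k] (V ⊗[k] C) :=
  α k A V C ∘ₗ rTensor C R1 ∘ₗ α' k V A C ∘ₗ lTensor V R3 ∘ₗ α k V C A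

/-- The map `σ = (id_A ⊗ id_V ⊗ μ_C)∘(E ⊗ μ_C)∘(id_V ⊗ R2 ⊗ id_C)`,
  `σ((v ⊗ c) ⊗ (v' ⊗ c')) = E_A(v, v'_{R2}) ⊗ (E_V(v, v'_{R2}) ⊗ E_C(v, v'_{R2}) c_{R2} c')`. -/
def tsSigma (R2 : C ⊗[k] V →ₗ[k] V ⊗[k] C) (E : V ⊗[k] V →ₗ[k] (A ⊗[k] V) ⊗[k] C) :
    (V ⊗[k] C) ⊗[k] (V ⊗[k] C) →ₗ[k] A ⊗[k] (V ⊗[k] C) :=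
  α k A V C ∘ₗ mulXC k (A ⊗[k] V) C ∘ₗ rTensor C E ∘ₗ α' k V V C
    ∘ₗ lTensor V (lTensor V (mul' k C)) ∘ₗ lTensor V (α k V C C)
    ∘ₗ lTensor V (rTensor C R2) ∘ₗ lTensor V (α' k C V C) ∘ₗ α k V C (V ⊗[k] C)

/-- The multiplication of the two-sided crossed product `A ⋊ V ⋉ C`:
  `(a ⊗ v ⊗ c)(a' ⊗ v' ⊗ c') = a (a'_{R3})_{R1} E_A(v_{R1}, v'_{R2}) ⊗ E_V(v_{R1}, v'_{R2})
    ⊗ E_C(v_{R1}, v'_{R2}) (c_{R3})_{R2} c'`. -/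
def tsMul (R1 : V ⊗[k] A →ₗ[k] A ⊗[k] V) (R2 : C ⊗[k] V →ₗ[k] V ⊗[k] C)
    (R3 : C ⊗[k] A →ₗ[k] A ⊗[k] C) (E : V ⊗[k] V →ₗ[k] (A ⊗[k] V) ⊗[k] C) :
    ((A ⊗[k] V) ⊗[k] C) ⊗[k] ((A ⊗[k] V) ⊗[k] C) →ₗ[k] (A ⊗[k] V) ⊗[k] C :=
  lTensor (A ⊗[k] V) (mul' k C) ∘ₗ α k (A ⊗[k] V) C C
    ∘ₗ rTensor C (tsNu k A V C R1 E) ∘ₗ α' k (A ⊗[k] V) (A ⊗[k] V) C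
    ∘ₗ lTensor (A ⊗[k] V) (lTensor (A ⊗[k] V) (mul' k C))
    ∘ₗ lTensor (A ⊗[k] V) (α k (A ⊗[k] V) C C)
    ∘ₗ lTensor (A ⊗[k] V) (rTensor C (tsP k A V C R2 R3))
    ∘ₗ lTensor (A ⊗[k] V) (α' k C (A ⊗[k] V) C)
    ∘ₗ α k (A ⊗[k] V) C ((A ⊗[k] V) ⊗[k] C)

/-- The canonical linear isomorphism `A ⊗ V ⊗ C ≅ V ⊗ (A ⊗ C)`. -/
def phiVAC : ((A ⊗[k] V) ⊗[k] C) ≃ₗ[k] V ⊗[k] (A ⊗[k] C) :=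
  (TensorProduct.congr (TensorProduct.comm k A V) (LinearEquiv.refl k C)).trans
    (TensorProduct.assoc k V A C)

end TwoSided

section Iterated
variable (A B C : Type*) [Ring A] [Algebra k A] [Ring B] [Algebra k B] [Ring C] [Algebra k C]

/-- The multiplication of the iterated twisted tensor product:
  `(a ⊗ b ⊗ c)(a' ⊗ b' ⊗ c') = a (a'_{R3})_{R1} ⊗ b_{R1} b'_{R2} ⊗ (c_{R3})_{R2} c'`. -/
def iterMul (R1 : B ⊗[k] A →ₗ[k] A ⊗[k] B) (R2 : C ⊗[k] B →ₗ[k] B ⊗[k] C)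
    (R3 : C ⊗[k] A →ₗ[k] A ⊗[k] C) :
    ((A ⊗[k] B) ⊗[k] C) ⊗[k] ((A ⊗[k] B) ⊗[k] C) →ₗ[k] (A ⊗[k] B) ⊗[k] C :=
  rTensor C (twistMul k A B R1) ∘ₗ α' k (A ⊗[k] B) (A ⊗[k] B) C
    ∘ₗ lTensor (A ⊗[k] B) (lTensor (A ⊗[k] B) (mul' k C))
    ∘ₗ lTensor (A ⊗[k] B) (α k (A ⊗[k] B) C C)
    ∘ₗ lTensor (A ⊗[k] B) (rTensor C (tsP k A B C R2 R3))
    ∘ₗ lTensor (A ⊗[k] B) (α' k C (A ⊗[k] B) C)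
    ∘ₗ α k (A ⊗[k] B) C ((A ⊗[k] B) ⊗[k] C)

end Iterated

section Helpers
variable {k}
variable {A V C : Type*} [Ring A] [Algebra k A] [AddCommGroup V] [Module k V]
  [Ring C] [Algebra k C]

/-- left multiplication by `A` -/
def opA : A →ₗ[k] Module.End k ((A ⊗[k] V) ⊗[k] C) :=
  TensorProduct.curry (rTensor C (mulAV k A V) ∘ₗ α' k A (A ⊗[k] V) C)

/-- right multiplication by `C` -/
def rC : C →ₗ[k] Module.End k ((A ⊗[k] V) ⊗[k] C) :=
  (TensorProduct.curry (mulXC k (A ⊗[k] V) C)).flip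

@[simp] lemma opA_tmul (a b : A) (v : V) (c : C) :
    opA (k := k) a ((b ⊗ₜ v) ⊗ₜ c) = ((a * b) ⊗ₜ[k] v) ⊗ₜ[k] c := by
  simp [opA, mulAV]

@[simp] lemma rC_tmul (w : A ⊗[k] V) (c d : C) :
    rC (k := k) d (w ⊗ₜ c) = w ⊗ₜ[k] (c * d) := by
  simp [rC, mulXC]

lemma opA_mul (a b : A) :
    opA (k := k) (V := V) (C := C) (a * b) = opA a * opA b := by
  ext x y z
  simp [mul_assoc]

lemma opA_one : opA (k := k) (V := V) (C := C) (1 : A) = 1 := by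
  ext x y z
  simp

lemma rC_rC (c d : C) (m : (A ⊗[k] V) ⊗[k] C) : rC d (rC c m) = rC (c * d) m := by
  induction m using TensorProduct.induction_on with
  | zero => simp
  | tmul x y => simp [mul_assoc]
  | add x y hx hy => simp only [map_add, hx, hy]

lemma opA_rC (a : A) (c : C) (m : (A ⊗[k] V) ⊗[k] C) : opA a (rC c m) = rC c (opA a m) := by
  induction m using TensorProduct.induction_on with
  | zero => simp
  | tmul x y =>
    induction x using TensorProduct.induction_on with
    | zero => simp
    | tmul x z => simp
    | add x y hx hy => simp only [map_add, add_tmul, hx, hy]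
  | add x y hx hy => simp only [map_add, hx, hy]

/-- `Ξ (a ⊗ v) v' = a · E(v ⊗ v')`. -/
def Xi (E : V ⊗[k] V →ₗ[k] (A ⊗[k] V) ⊗[k] C) :
    A ⊗[k] V →ₗ[k] V →ₗ[k] (A ⊗[k] V) ⊗[k] C :=
  TensorProduct.lift (LinearMap.mk₂ k (fun a v => opA a ∘ₗ TensorProduct.curry E v)
    (by intros; ext; simp) (by intros; ext; simp) (by intros; ext; simp) (by intros; ext; simp))

@[simp] lemma Xi_tmul (E : V ⊗[k] V →ₗ[k] (A ⊗[k] V) ⊗[k] C) (a : A) (v v' : V) :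
    Xi E (a ⊗ₜ v) v' = opA a (E (v ⊗ₜ v')) := by
  simp [Xi]

/-- `Π (a ⊗ c) v = a ⊗ R2 (c ⊗ v)`. -/
def Pii (R2 : C ⊗[k] V →ₗ[k] V ⊗[k] C) :
    A ⊗[k] C →ₗ[k] V →ₗ[k] (A ⊗[k] V) ⊗[k] C :=
  TensorProduct.curry (α' k A V C ∘ₗ lTensor A R2 ∘ₗ α k A C V)

@[simp] lemma Pii_tmul (R2 : C ⊗[k] V →ₗ[k] V ⊗[k] C) (a : A) (c : C) (v : V) :
    Pii R2 (a ⊗ₜ c) v = (TensorProduct.assoc k A V C).symm (a ⊗ₜ R2 (c ⊗ₜ v)) := by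
  simp [Pii]

/-- extend a map `A ⊗ V → M` to a right `C`-linear map. -/
def ext3 {X : Type*} [AddCommGroup X] [Module k X]
    (f : X →ₗ[k] A →ₗ[k] V →ₗ[k] (A ⊗[k] V) ⊗[k] C) :
    X →ₗ[k] Module.End k ((A ⊗[k] V) ⊗[k] C) where
  toFun x := mulXC k (A ⊗[k] V) C ∘ₗ rTensor C (TensorProduct.lift (f x))
  map_add' x y := by ext; simp [add_tmul]
  map_smul' r x := by ext; simp [← smul_tmul']

@[simp] lemma ext3_tmul {X : Type*} [AddCommGroup X] [Module k X]
    (f : X →ₗ[k] A →ₗ[k] V →ₗ[k] (A ⊗[k] V) ⊗[k] C) (x : X) (a : A) (v : V) (c : C) :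
    ext3 f x ((a ⊗ₜ v) ⊗ₜ c) = rC c (f x a v) := by
  simp [ext3, rC]

lemma ext3_rC {X : Type*} [AddCommGroup X] [Module k X]
    (f : X →ₗ[k] A →ₗ[k] V →ₗ[k] (A ⊗[k] V) ⊗[k] C) (x : X) (c : C)
    (m : (A ⊗[k] V) ⊗[k] C) : ext3 f x (rC c m) = rC c (ext3 f x m) := by
  induction m using TensorProduct.induction_on with
  | zero => simp
  | tmul x y =>
    induction x using TensorProduct.induction_on with
    | zero => simp
    | tmul x z => simp [rC_rC]
    | add x y hx hy => simp only [map_add, add_tmul, hx, hy]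
  | add x y hx hy => simp only [map_add, hx, hy]

/-- left multiplication by `V` -/
def opV (R1 : V ⊗[k] A →ₗ[k] A ⊗[k] V) (E : V ⊗[k] V →ₗ[k] (A ⊗[k] V) ⊗[k] C) :
    V →ₗ[k] Module.End k ((A ⊗[k] V) ⊗[k] C) :=
  ext3 (TensorProduct.curry (Xi E ∘ₗ R1))

/-- left multiplication by `C` -/
def opC (R2 : C ⊗[k] V →ₗ[k] V ⊗[k] C) (R3 : C ⊗[k] A →ₗ[k] A ⊗[k] C) :
    C →ₗ[k] Module.End k ((A ⊗[k] V) ⊗[k] C) :=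
  ext3 (TensorProduct.curry (Pii R2 ∘ₗ R3))

@[simp] lemma opV_tmul (R1 : V ⊗[k] A →ₗ[k] A ⊗[k] V)
    (E : V ⊗[k] V →ₗ[k] (A ⊗[k] V) ⊗[k] C) (v v' : V) (a : A) (c : C) :
    opV R1 E v ((a ⊗ₜ v') ⊗ₜ c) = rC c (Xi E (R1 (v ⊗ₜ a)) v') := by
  simp [opV]

@[simp] lemma opC_tmul (R2 : C ⊗[k] V →ₗ[k] V ⊗[k] C) (R3 : C ⊗[k] A →ₗ[k] A ⊗[k] C)
    (v' : V) (a : A) (c d : C) :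
    opC R2 R3 d ((a ⊗ₜ v') ⊗ₜ c) = rC c (Pii R2 (R3 (d ⊗ₜ a)) v') := by
  simp [opC]

lemma opV_rC (R1 : V ⊗[k] A →ₗ[k] A ⊗[k] V)
    (E : V ⊗[k] V →ₗ[k] (A ⊗[k] V) ⊗[k] C) (v : V) (c : C) (m : (A ⊗[k] V) ⊗[k] C) :
    opV R1 E v (rC c m) = rC c (opV R1 E v m) := ext3_rC _ _ _ _

lemma opC_rC (R2 : C ⊗[k] V →ₗ[k] V ⊗[k] C) (R3 : C ⊗[k] A →ₗ[k] A ⊗[k] C)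
    (d : C) (c : C) (m : (A ⊗[k] V) ⊗[k] C) :
    opC R2 R3 d (rC c m) = rC c (opC R2 R3 d m) := ext3_rC _ _ _ _

/-- combine two families of operators -/
def comb {X Y N : Type*} [AddCommGroup X] [Module k X] [AddCommGroup Y] [Module k Y]
    [AddCommMonoid N] [Module k N]
    (f : X →ₗ[k] Module.End k N) (g : Y →ₗ[k] Module.End k N) :
    X ⊗[k] Y →ₗ[k] Module.End k N :=
  mul' k (Module.End k N) ∘ₗ TensorProduct.map f g

@[simp] lemma comb_tmul {X Y N : Type*} [AddCommGroup X] [Module k X] [AddCommGroup Y]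
    [Module k Y] [AddCommMonoid N] [Module k N]
    (f : X →ₗ[k] Module.End k N) (g : Y →ₗ[k] Module.End k N) (x : X) (y : Y) :
    comb f g (x ⊗ₜ y) = f x * g y := by
  simp [comb]

/-- left multiplication by `A ⊗ V ⊗ C` -/
def Lam (R1 : V ⊗[k] A →ₗ[k] A ⊗[k] V) (R2 : C ⊗[k] V →ₗ[k] V ⊗[k] C)
    (R3 : C ⊗[k] A →ₗ[k] A ⊗[k] C) (E : V ⊗[k] V →ₗ[k] (A ⊗[k] V) ⊗[k] C) :
    (A ⊗[k] V) ⊗[k] C →ₗ[k] Module.End k ((A ⊗[k] V) ⊗[k] C) :=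
  comb (comb opA (opV R1 E)) (opC R2 R3)

/-- operators which are right `C`-linear agree if they agree on `a ⊗ v ⊗ 1`. -/
lemma op_ext {f g : Module.End k ((A ⊗[k] V) ⊗[k] C)}
    (hf : ∀ c m, f (rC c m) = rC c (f m)) (hg : ∀ c m, g (rC c m) = rC c (g m))
    (H : ∀ (a : A) (v : V), f ((a ⊗ₜ v) ⊗ₜ 1) = g ((a ⊗ₜ v) ⊗ₜ 1)) : f = g := by
  ext a v c
  have : ((a ⊗ₜ[k] v) ⊗ₜ[k] c) = rC c ((a ⊗ₜ[k] v) ⊗ₜ[k] (1 : C)) := by simp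
  simp only [TensorProduct.AlgebraTensorModule.curry_apply, LinearMap.coe_restrictScalars,
    TensorProduct.curry_apply, LinearMap.restrictScalars_self]
  rw [this, hf, hg, H]

lemma rC_one (m : (A ⊗[k] V) ⊗[k] C) : rC 1 m = m := by
  induction m using TensorProduct.induction_on with
  | zero => simp
  | tmul x y => simp
  | add x y hx hy => simp only [map_add, hx, hy]

lemma comb_rC {X Y : Type*} [AddCommGroup X] [Module k X] [AddCommGroup Y]
    [Module k Y] (f : X →ₗ[k] Module.End k ((A ⊗[k] V) ⊗[k] C))
    (g : Y →ₗ[k] Module.End k ((A ⊗[k] V) ⊗[k] C))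
    (hf : ∀ x c m, f x (rC c m) = rC c (f x m)) (hg : ∀ x c m, g x (rC c m) = rC c (g x m))
    (t : X ⊗[k] Y) (c : C) (m) : comb f g t (rC c m) = rC c (comb f g t m) := by
  induction t using TensorProduct.induction_on with
  | zero => simp
  | tmul x y => simp [hf, hg]
  | add x y hx hy => simp only [map_add, LinearMap.add_apply, hx, hy]

variable {e : V} {R1 : V ⊗[k] A →ₗ[k] A ⊗[k] V} {R2 : C ⊗[k] V →ₗ[k] V ⊗[k] C}
  {R3 : C ⊗[k] A →ₗ[k] A ⊗[k] C} {E : V ⊗[k] V →ₗ[k] (A ⊗[k] V) ⊗[k] C}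

lemma Lam_rC (t : (A ⊗[k] V) ⊗[k] C) (c : C) (m) :
    Lam R1 R2 R3 E t (rC c m) = rC c (Lam R1 R2 R3 E t m) :=
  comb_rC _ _ (comb_rC _ _ opA_rC (opV_rC R1 E)) (opC_rC R2 R3) _ _ _

lemma Xi_mul (a : A) (s : A ⊗[k] V) (v : V) :
    Xi E (rTensor V (mul' k A) ((TensorProduct.assoc k A A V).symm (a ⊗ₜ s))) v
      = opA a (Xi E s v) := by
  induction s using TensorProduct.induction_on with
  | zero => simp
  | tmul x y => simp [opA_mul]
  | add x y hx hy => simp only [map_add, tmul_add, LinearMap.add_apply, hx, hy]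

lemma assoc_mul (a b : A) (q : V ⊗[k] C) :
    (TensorProduct.assoc k A V C).symm ((a * b) ⊗ₜ q) =
      opA a ((TensorProduct.assoc k A V C).symm (b ⊗ₜ q)) := by
  induction q using TensorProduct.induction_on with
  | zero => simp
  | tmul x y => simp
  | add x y hx hy => simp only [map_add, tmul_add, hx, hy]

lemma Pii_mul (a : A) (s : A ⊗[k] C) (v : V) :
    Pii R2 (rTensor C (mul' k A) ((TensorProduct.assoc k A A C).symm (a ⊗ₜ s))) v
      = opA a (Pii R2 s v) := by
  induction s using TensorProduct.induction_on with
  | zero => simp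
  | tmul x y => simp [assoc_mul]
  | add x y hx hy => simp only [map_add, tmul_add, LinearMap.add_apply, hx, hy]

/-- relation (2) -/
lemma opV_opA (h : IsTwoSidedData k A V C e R1 R2 R3 E) (v : V) (a : A) :
    opV R1 E v * opA a = comb opA (opV R1 E) (R1 (v ⊗ₜ a)) := by
  refine op_ext (by simp [opV_rC, opA_rC]) (comb_rC _ _ opA_rC (opV_rC R1 E) _) ?_
  intro a' v'
  have h1 := LinearMap.congr_fun h.eq1 ((v ⊗ₜ a) ⊗ₜ a')
  simp only [LinearMap.comp_apply, LinearEquiv.coe_coe, TensorProduct.assoc_tmul,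
    lTensor_tmul, rTensor_tmul, mul'_apply] at h1
  simp only [Module.End.mul_apply, opA_tmul, opV_tmul, rC_one, h1]
  generalize R1 (v ⊗ₜ a) = t
  induction t using TensorProduct.induction_on with
  | zero => simp
  | tmul x y => simp [Xi_mul, rC_one]
  | add x y hx hy => simp only [map_add, add_tmul, LinearMap.add_apply, hx, hy]

/-- relation (3) -/
lemma opC_opA (h : IsTwoSidedData k A V C e R1 R2 R3 E) (c : C) (a : A) :
    opC R2 R3 c * opA a = comb opA (opC R2 R3) (R3 (c ⊗ₜ a)) := by
  refine op_ext (by simp [opC_rC, opA_rC]) (comb_rC _ _ opA_rC (opC_rC R2 R3) _) ?_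
  intro a' v'
  have h1 := LinearMap.congr_fun h.twist.mul_left ((c ⊗ₜ a) ⊗ₜ a')
  simp only [LinearMap.comp_apply, LinearEquiv.coe_coe, TensorProduct.assoc_tmul,
    lTensor_tmul, rTensor_tmul, mul'_apply] at h1
  simp only [Module.End.mul_apply, opA_tmul, opC_tmul, rC_one, h1]
  generalize R3 (c ⊗ₜ a) = t
  induction t using TensorProduct.induction_on with
  | zero => simp
  | tmul x y => simp [Pii_mul, rC_one]
  | add x y hx hy => simp only [map_add, add_tmul, LinearMap.add_apply, hx, hy]

/-- `opC` on `1 ⊗ v ⊗ c` -/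
lemma opC_one_tmul (h : IsTwoSidedData k A V C e R1 R2 R3 E) (d : C) (v : V) :
    opC R2 R3 d (((1 : A) ⊗ₜ v) ⊗ₜ 1) =
      (TensorProduct.assoc k A V C).symm (1 ⊗ₜ R2 (d ⊗ₜ v)) := by
  simp [h.twist.unit_right, rC_one]

lemma tmul_eq_opA (a : A) (v : V) :
    ((a ⊗ₜ[k] v) ⊗ₜ[k] (1 : C)) = opA a (((1 : A) ⊗ₜ v) ⊗ₜ 1) := by simp

/-- relation (1) -/
lemma opC_mul (h : IsTwoSidedData k A V C e R1 R2 R3 E) (c d : C) :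
    opC (A := A) R2 R3 (c * d) = opC R2 R3 c * opC R2 R3 d := by
  refine op_ext (by simp [opC_rC]) (by simp [opC_rC]) ?_
  intro a v
  have h1 := LinearMap.congr_fun h.twist.mul_right ((c ⊗ₜ d) ⊗ₜ a)
  simp only [LinearMap.comp_apply, LinearEquiv.coe_coe, TensorProduct.assoc_tmul,
    lTensor_tmul, rTensor_tmul, mul'_apply] at h1
  simp only [Module.End.mul_apply, opC_tmul, rC_one, h1]
  generalize R3 (d ⊗ₜ a) = t
  induction t using TensorProduct.induction_on with
  | zero => simp
  | add x y hx hy => simp only [map_add, add_tmul, tmul_add, LinearMap.add_apply, hx, hy]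
  | tmul x y =>
    have key : ∀ q : V ⊗[k] C, opC R2 R3 c ((TensorProduct.assoc k A V C).symm (x ⊗ₜ q))
        = comb opA (opC R2 R3) (R3 (c ⊗ₜ x))
          ((TensorProduct.assoc k A V C).symm (1 ⊗ₜ q)) := by
      intro q
      rw [← opC_opA h, Module.End.mul_apply, ← assoc_mul, mul_one]
    simp only [Pii_tmul, key, TensorProduct.assoc_symm_tmul, rTensor_tmul]
    generalize R3 (c ⊗ₜ x) = s
    induction s using TensorProduct.induction_on with
    | zero => simp
    | add x y hx hy => simp only [map_add, add_tmul, LinearMap.add_apply, hx, hy]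
    | tmul x' y' =>
      have h2 := LinearMap.congr_fun h.eq2 ((y' ⊗ₜ y) ⊗ₜ v)
      simp only [LinearMap.comp_apply, LinearEquiv.coe_coe, TensorProduct.assoc_tmul,
        lTensor_tmul, rTensor_tmul, mul'_apply] at h2
      simp only [TensorProduct.assoc_tmul, lTensor_tmul, mul'_apply, Pii_tmul, h2, comb_tmul,
        Module.End.mul_apply]
      generalize R2 (y ⊗ₜ v) = q
      induction q using TensorProduct.induction_on with
      | zero => simp
      | add x y hx hy => simp only [map_add, tmul_add, hx, hy]
      | tmul v1 c1 =>
        simp only [TensorProduct.assoc_symm_tmul, rTensor_tmul, opC_tmul, h.twist.unit_right,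
          Pii_tmul]
        generalize R2 (y' ⊗ₜ v1) = q
        induction q using TensorProduct.induction_on with
        | zero => simp
        | add x y hx hy => simp only [map_add, tmul_add, add_tmul, hx, hy]
        | tmul v1 c1 => simp

/-- auxiliary map for relation (4) -/
def Hmap (R2 : C ⊗[k] V →ₗ[k] V ⊗[k] C) (E : V ⊗[k] V →ₗ[k] (A ⊗[k] V) ⊗[k] C) (v' : V) :
    V ⊗[k] C →ₗ[k] (A ⊗[k] V) ⊗[k] C :=
  mulXC k (A ⊗[k] V) C ∘ₗ rTensor C E ∘ₗ α' k V V C ∘ₗ lTensor V R2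
        ∘ₗ α k V C V ∘ₗ (TensorProduct.mk k (V ⊗[k] C) V).flip v'

/-- auxiliary map for relation (4) -/
def Gmap (R2 : C ⊗[k] V →ₗ[k] V ⊗[k] C) (E : V ⊗[k] V →ₗ[k] (A ⊗[k] V) ⊗[k] C) (v' : V) :
    A ⊗[k] (V ⊗[k] C) →ₗ[k] (A ⊗[k] V) ⊗[k] C :=
  rTensor C (mulAV k A V) ∘ₗ α' k A (A ⊗[k] V) C ∘ₗ lTensor A (Hmap R2 E v')

@[simp] lemma Gmap_tmul (v' : V) (a : A) (u : V ⊗[k] C) :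
    Gmap R2 E v' (a ⊗ₜ u) = opA a (Hmap R2 E v' u) := by
  simp [Gmap, opA]

lemma opC_eq (c : C) (m : (A ⊗[k] V) ⊗[k] C) :
    (mulXC k (A ⊗[k] V) C ∘ₗ rTensor C (α' k A V C) ∘ₗ rTensor C (lTensor A R2)
        ∘ₗ rTensor C (α k A C V) ∘ₗ rTensor C (rTensor V R3) ∘ₗ rTensor C (α' k C A V)
        ∘ₗ α' k C (A ⊗[k] V) C) (c ⊗ₜ m) = opC R2 R3 c m := by
  induction m using TensorProduct.induction_on with
  | zero => simp
  | tmul x y =>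
    induction x using TensorProduct.induction_on with
    | zero => simp
    | tmul x z => simp [Pii, rC]
    | add x y hx hy => simp only [map_add, add_tmul, tmul_add, hx, hy]
  | add x y hx hy => simp only [map_add, tmul_add, hx, hy]

lemma opC_E (h : IsTwoSidedData k A V C e R1 R2 R3 E) (c : C) (v v' : V) :
    opC R2 R3 c (E (v ⊗ₜ v')) = Hmap R2 E v' (R2 (c ⊗ₜ v)) := by
  rw [← opC_eq]
  have h1 := LinearMap.congr_fun h.eq5 ((c ⊗ₜ v) ⊗ₜ v')
  simp only [LinearMap.comp_apply, LinearEquiv.coe_coe, TensorProduct.assoc_tmul,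
    lTensor_tmul, rTensor_tmul] at h1
  simp only [LinearMap.comp_apply, LinearEquiv.coe_coe, Hmap, LinearMap.flip_apply,
    TensorProduct.mk_apply, h1]

/-- relation (4) -/
lemma opC_opV (h : IsTwoSidedData k A V C e R1 R2 R3 E) (c : C) (v : V) :
    opC R2 R3 c * opV R1 E v = comb (opV R1 E) (opC R2 R3) (R2 (c ⊗ₜ v)) := by
  refine op_ext (by simp [opC_rC, opV_rC]) (comb_rC _ _ (opV_rC R1 E) (opC_rC R2 R3) _) ?_
  intro a v'
  have h1 := LinearMap.congr_fun h.eq3 (c ⊗ₜ (v ⊗ₜ a))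
  simp only [LinearMap.comp_apply, LinearEquiv.coe_coe, TensorProduct.assoc_symm_tmul,
    lTensor_tmul, rTensor_tmul] at h1
  have hL : ∀ t : A ⊗[k] V, opC R2 R3 c (Xi E t v') = Gmap R2 E v' (lTensor A R2
      (TensorProduct.assoc k A C V (rTensor V R3
        ((TensorProduct.assoc k C A V).symm (c ⊗ₜ t))))) := by
    intro t
    induction t using TensorProduct.induction_on with
    | zero => simp
    | add x y hx hy => simp only [map_add, tmul_add, LinearMap.add_apply, hx, hy]
    | tmul a1 v1 =>
      rw [Xi_tmul, ← Module.End.mul_apply, opC_opA h]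
      simp only [TensorProduct.assoc_symm_tmul, rTensor_tmul]
      generalize R3 (c ⊗ₜ a1) = s
      induction s using TensorProduct.induction_on with
      | zero => simp
      | add x y hx hy => simp only [map_add, add_tmul, LinearMap.add_apply, hx, hy]
      | tmul a2 c2 => simp [opC_E h]
  simp only [Module.End.mul_apply, opV_tmul, rC_one, hL, h1]
  generalize R2 (c ⊗ₜ v) = u
  induction u using TensorProduct.induction_on with
  | zero => simp
  | add x y hx hy => simp only [map_add, add_tmul, LinearMap.add_apply, hx, hy]
  | tmul v1 c1 =>
    simp only [comb_tmul, Module.End.mul_apply, opC_tmul, rC_one, TensorProduct.assoc_tmul,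
      lTensor_tmul]
    generalize R3 (c1 ⊗ₜ a) = s
    induction s using TensorProduct.induction_on with
    | zero => simp
    | add x y hx hy => simp only [map_add, tmul_add, LinearMap.add_apply, hx, hy]
    | tmul a2 c2 =>
      have hR : ∀ (q : V ⊗[k] C) (a : A), opV R1 E v1 ((TensorProduct.assoc k A V C).symm
          (a ⊗ₜ q)) = comb opA (opV R1 E) (R1 (v1 ⊗ₜ a)) ((TensorProduct.assoc k A V C).symm
          (1 ⊗ₜ q)) := by
        intro q a
        rw [← opV_opA h, Module.End.mul_apply, ← assoc_mul, mul_one]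
      simp only [Pii_tmul, hR, TensorProduct.assoc_symm_tmul, rTensor_tmul]
      generalize R1 (v1 ⊗ₜ a2) = t
      induction t using TensorProduct.induction_on with
      | zero => simp
      | add x y hx hy => simp only [map_add, add_tmul, LinearMap.add_apply, hx, hy]
      | tmul a3 v3 =>
        simp only [TensorProduct.assoc_tmul, Gmap_tmul, comb_tmul, Module.End.mul_apply, Hmap,
          LinearMap.comp_apply, LinearEquiv.coe_coe, LinearMap.flip_apply,
          TensorProduct.mk_apply, lTensor_tmul]
        generalize R2 (c2 ⊗ₜ v') = q
        induction q using TensorProduct.induction_on with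
        | zero => simp
        | add x y hx hy => simp only [map_add, tmul_add, hx, hy]
        | tmul v1 c1 => simp [h.r1b, opA_one, rC]

lemma Lam_opA (a : A) (m : (A ⊗[k] V) ⊗[k] C) :
    Lam R1 R2 R3 E (opA a m) = opA a * Lam R1 R2 R3 E m := by
  induction m using TensorProduct.induction_on with
  | zero => simp
  | tmul x y =>
    induction x using TensorProduct.induction_on with
    | zero => simp
    | tmul x z => simp [Lam, opA_mul, mul_assoc]
    | add x y hx hy => simp only [map_add, add_tmul, hx, hy, mul_add]
  | add x y hx hy => simp only [map_add, hx, hy, mul_add]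

lemma Lam_of_rC (h : IsTwoSidedData k A V C e R1 R2 R3 E) (c : C) (m : (A ⊗[k] V) ⊗[k] C) :
    Lam R1 R2 R3 E (rC c m) = Lam R1 R2 R3 E m * opC R2 R3 c := by
  induction m using TensorProduct.induction_on with
  | zero => simp
  | tmul x y => simp [Lam, opC_mul h, mul_assoc]
  | add x y hx hy => simp only [map_add, hx, hy, add_mul]

lemma opV_E (h : IsTwoSidedData k A V C e R1 R2 R3 E) (v v' v'' : V) :
    opV R1 E v (E (v' ⊗ₜ v'')) = Lam R1 R2 R3 E (E (v ⊗ₜ v')) ((1 ⊗ₜ v'') ⊗ₜ 1) := by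
  have h1 := LinearMap.congr_fun h.eq6 ((v ⊗ₜ v') ⊗ₜ v'')
  simp only [LinearMap.comp_apply, LinearEquiv.coe_coe, TensorProduct.assoc_tmul,
    lTensor_tmul, rTensor_tmul] at h1
  have hL : ∀ m : (A ⊗[k] V) ⊗[k] C, (tsTail k A V C) (rTensor C (lTensor A E)
      (rTensor C (α k A V V) (rTensor C (rTensor V R1) (rTensor C (α' k V A V)
        ((TensorProduct.assoc k V (A ⊗[k] V) C).symm (v ⊗ₜ m)))))) = opV R1 E v m := by
    intro m
    induction m using TensorProduct.induction_on with
    | zero => simp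
    | add x y hx hy => simp only [map_add, tmul_add, hx, hy]
    | tmul x c =>
      induction x using TensorProduct.induction_on with
      | zero => simp
      | add x y hx hy => simp only [map_add, add_tmul, tmul_add, hx, hy]
      | tmul a w =>
        simp only [TensorProduct.assoc_symm_tmul, rTensor_tmul, LinearEquiv.coe_coe, opV_tmul]
        generalize R1 (v ⊗ₜ a) = t
        induction t using TensorProduct.induction_on with
        | zero => simp
        | add x y hx hy => simp only [map_add, add_tmul, LinearMap.add_apply, hx, hy]
        | tmul a1 v1 => simp [tsTail, rC, opA]
  have hR : ∀ m : (A ⊗[k] V) ⊗[k] C, (tsTail k A V C) (rTensor C (lTensor A E)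
      (rTensor C (α k A V V) ((TensorProduct.assoc k (A ⊗[k] V) V C).symm
        (lTensor (A ⊗[k] V) R2 (TensorProduct.assoc k (A ⊗[k] V) C V (m ⊗ₜ v''))))))
        = Lam R1 R2 R3 E m ((1 ⊗ₜ v'') ⊗ₜ 1) := by
    intro m
    induction m using TensorProduct.induction_on with
    | zero => simp
    | add x y hx hy => simp only [map_add, add_tmul, LinearMap.add_apply, hx, hy]
    | tmul x c =>
      induction x using TensorProduct.induction_on with
      | zero => simp
      | add x y hx hy => simp only [map_add, add_tmul, LinearMap.add_apply, hx, hy]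
      | tmul a w =>
        simp only [Lam, comb_tmul, Module.End.mul_apply, opC_one_tmul h,
          TensorProduct.assoc_tmul, lTensor_tmul]
        generalize R2 (c ⊗ₜ v'') = t
        induction t using TensorProduct.induction_on with
        | zero => simp
        | add x y hx hy => simp only [map_add, tmul_add, hx, hy]
        | tmul v1 c1 => simp [tsTail, h.r1b, opA_one, opA_rC]; simp [rC, opA]
  rw [hL, hR] at h1
  exact h1

/-- relation (5) -/
lemma opV_opV (h : IsTwoSidedData k A V C e R1 R2 R3 E) (v v' : V) :
    opV R1 E v * opV R1 E v' = Lam R1 R2 R3 E (E (v ⊗ₜ v')) := by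
  refine op_ext (by simp [opV_rC]) (Lam_rC _) ?_
  intro a v''
  have h1 := LinearMap.congr_fun h.eq4 ((v ⊗ₜ v') ⊗ₜ a)
  simp only [LinearMap.comp_apply, LinearEquiv.coe_coe, TensorProduct.assoc_tmul,
    lTensor_tmul, rTensor_tmul] at h1
  have hR : ∀ m : (A ⊗[k] V) ⊗[k] C, Lam R1 R2 R3 E m * opA a = Lam R1 R2 R3 E
      (rTensor C (mulAV k A V) (rTensor C (lTensor A R1) (rTensor C (α k A V A)
        ((TensorProduct.assoc k (A ⊗[k] V) A C).symm (lTensor (A ⊗[k] V) R3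
          (TensorProduct.assoc k (A ⊗[k] V) C A (m ⊗ₜ a))))))) := by
    intro m
    induction m using TensorProduct.induction_on with
    | zero => simp
    | add x y hx hy => simp only [map_add, add_tmul, add_mul, hx, hy]
    | tmul x c =>
      induction x using TensorProduct.induction_on with
      | zero => simp
      | add x y hx hy => simp only [map_add, add_tmul, add_mul, hx, hy]
      | tmul a1 v1 =>
        simp only [Lam, comb_tmul, mul_assoc, opC_opA h, TensorProduct.assoc_tmul,
          lTensor_tmul]
        generalize R3 (c ⊗ₜ a) = s
        induction s using TensorProduct.induction_on with
        | zero => simp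
        | add x y hx hy => simp only [map_add, tmul_add, mul_add, hx, hy]
        | tmul a2 c2 =>
          simp only [comb_tmul, TensorProduct.assoc_symm_tmul, rTensor_tmul,
            LinearEquiv.coe_coe, TensorProduct.assoc_tmul, lTensor_tmul]
          rw [← mul_assoc (opV R1 E v1), opV_opA h]
          generalize R1 (v1 ⊗ₜ a2) = s
          induction s using TensorProduct.induction_on with
          | zero => simp
          | add x y hx hy => simp only [map_add, tmul_add, add_tmul, mul_add, add_mul, hx, hy]
          | tmul a3 v3 => simp [mulAV, opA_mul, mul_assoc]
  have hL : ∀ t : A ⊗[k] V, opV R1 E v (comb opA (opV R1 E) t ((1 ⊗ₜ v'') ⊗ₜ 1)) =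
      Lam R1 R2 R3 E (rTensor C (mulAV k A V) ((TensorProduct.assoc k A (A ⊗[k] V) C).symm
        (lTensor A E (TensorProduct.assoc k A V V (rTensor V R1
          ((TensorProduct.assoc k V A V).symm (v ⊗ₜ t))))))) ((1 ⊗ₜ v'') ⊗ₜ 1) := by
    intro t
    induction t using TensorProduct.induction_on with
    | zero => simp
    | add x y hx hy => simp only [map_add, tmul_add, LinearMap.add_apply, hx, hy]
    | tmul a1 v1 =>
      rw [comb_tmul, Module.End.mul_apply, ← Module.End.mul_apply (opV R1 E v), opV_opA h]
      simp only [TensorProduct.assoc_symm_tmul, rTensor_tmul]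
      generalize R1 (v ⊗ₜ a1) = s
      induction s using TensorProduct.induction_on with
      | zero => simp
      | add x y hx hy => simp only [map_add, add_tmul, LinearMap.add_apply, hx, hy]
      | tmul a2 v2 =>
        have := Lam_opA (R1 := R1) (R2 := R2) (R3 := R3) (E := E) a2 (E (v2 ⊗ₜ v1))
        simp only [opA, TensorProduct.curry_apply, LinearMap.comp_apply, LinearEquiv.coe_coe]
          at this
        simp only [TensorProduct.assoc_tmul, lTensor_tmul, this, comb_tmul,
          Module.End.mul_apply, ← opV_E h]
        simp only [opV_tmul, h.r1b, Xi_tmul, opA_one, rC_one, Module.End.one_apply]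
        simp [opA]
  rw [tmul_eq_opA, Module.End.mul_apply, ← Module.End.mul_apply (opV R1 E v'), opV_opA h, hL,
    h1, ← hR, Module.End.mul_apply]

lemma Lam_opV (h : IsTwoSidedData k A V C e R1 R2 R3 E) (v : V) (m : (A ⊗[k] V) ⊗[k] C) :
    Lam R1 R2 R3 E (opV R1 E v m) = opV R1 E v * Lam R1 R2 R3 E m := by
  induction m using TensorProduct.induction_on with
  | zero => simp
  | add x y hx hy => simp only [map_add, hx, hy, mul_add]
  | tmul x y =>
    induction x using TensorProduct.induction_on with
    | zero => simp
    | add x y hx hy => simp only [map_add, add_tmul, hx, hy, mul_add]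
    | tmul a v' =>
      rw [opV_tmul, Lam_of_rC h]
      simp only [Lam, comb_tmul, ← mul_assoc, opV_opA h]
      congr 1
      generalize R1 (v ⊗ₜ a) = t
      induction t using TensorProduct.induction_on with
      | zero => simp
      | add x y hx hy => simp only [map_add, LinearMap.add_apply, hx, hy, add_mul]
      | tmul a1 v1 =>
        rw [comb_tmul, mul_assoc, opV_opV h, Xi_tmul]
        exact Lam_opA _ _

lemma Lam_opC (h : IsTwoSidedData k A V C e R1 R2 R3 E) (c : C) (m : (A ⊗[k] V) ⊗[k] C) :
    Lam R1 R2 R3 E (opC R2 R3 c m) = opC R2 R3 c * Lam R1 R2 R3 E m := by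
  induction m using TensorProduct.induction_on with
  | zero => simp
  | add x y hx hy => simp only [map_add, hx, hy, mul_add]
  | tmul x y =>
    induction x using TensorProduct.induction_on with
    | zero => simp
    | add x y hx hy => simp only [map_add, add_tmul, hx, hy, mul_add]
    | tmul a v =>
      rw [opC_tmul, Lam_of_rC h]
      simp only [Lam, comb_tmul, ← mul_assoc, opC_opA h]
      congr 1
      generalize R3 (c ⊗ₜ a) = t
      induction t using TensorProduct.induction_on with
      | zero => simp
      | add x y hx hy => simp only [map_add, LinearMap.add_apply, hx, hy, add_mul]
      | tmul a1 c1 =>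
        rw [comb_tmul, mul_assoc, opC_opV h, Pii_tmul]
        generalize R2 (c1 ⊗ₜ v) = t
        induction t using TensorProduct.induction_on with
        | zero => simp
        | add x y hx hy => simp only [map_add, tmul_add, hx, hy, mul_add]
        | tmul v1 c1 => simp [mul_assoc]

lemma Lam_Lam (h : IsTwoSidedData k A V C e R1 R2 R3 E) (x y : (A ⊗[k] V) ⊗[k] C) :
    Lam R1 R2 R3 E (Lam R1 R2 R3 E x y) = Lam R1 R2 R3 E x * Lam R1 R2 R3 E y := by
  induction x using TensorProduct.induction_on with
  | zero => simp
  | add x y hx hy => simp only [map_add, LinearMap.add_apply, hx, hy, add_mul]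
  | tmul x c =>
    induction x using TensorProduct.induction_on with
    | zero => simp
    | add x y hx hy => simp only [map_add, add_tmul, LinearMap.add_apply, hx, hy, add_mul]
    | tmul a v =>
      have : Lam R1 R2 R3 E ((a ⊗ₜ v) ⊗ₜ c) = opA a * opV R1 E v * opC R2 R3 c := by
        simp [Lam]
      rw [this]
      simp only [Module.End.mul_apply, Lam_opA, Lam_opV h, Lam_opC h, mul_assoc]

lemma tsMul_eq (x y : (A ⊗[k] V) ⊗[k] C) :
    tsMul k A V C R1 R2 R3 E (x ⊗ₜ y) = Lam R1 R2 R3 E x y := by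
  induction x using TensorProduct.induction_on with
  | zero => simp
  | add x y hx hy => simp only [map_add, add_tmul, LinearMap.add_apply, hx, hy]
  | tmul x c =>
  induction x using TensorProduct.induction_on with
  | zero => simp
  | add x y hx hy => simp only [map_add, add_tmul, LinearMap.add_apply, hx, hy]
  | tmul a v =>
  induction y using TensorProduct.induction_on with
  | zero => simp
  | add x y hx hy => simp only [map_add, tmul_add, hx, hy]
  | tmul y c' =>
  induction y using TensorProduct.induction_on with
  | zero => simp
  | add x y hx hy => simp only [map_add, add_tmul, tmul_add, hx, hy]
  | tmul a' v' =>
  have hP : tsP k A V C R2 R3 (c ⊗ₜ (a' ⊗ₜ v')) = Pii R2 (R3 (c ⊗ₜ a')) v' := by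
    simp [tsP, Pii]
  simp only [tsMul, LinearMap.comp_apply, LinearEquiv.coe_coe, TensorProduct.assoc_tmul,
    lTensor_tmul, TensorProduct.assoc_symm_tmul, rTensor_tmul, hP, Lam, comb_tmul,
    Module.End.mul_apply, opC_tmul]
  generalize Pii R2 (R3 (c ⊗ₜ a')) v' = m
  induction m using TensorProduct.induction_on with
  | zero => simp
  | add x y hx hy => simp only [map_add, add_tmul, tmul_add, hx, hy]
  | tmul y c1 =>
  induction y using TensorProduct.induction_on with
  | zero => simp
  | add x y hx hy => simp only [map_add, add_tmul, tmul_add, hx, hy]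
  | tmul a1 v1 =>
  have hN : tsNu k A V C R1 E ((a ⊗ₜ v) ⊗ₜ (a1 ⊗ₜ v1)) =
      opA a (Xi E (R1 (v ⊗ₜ a1)) v1) := by
    simp only [tsNu, LinearMap.comp_apply, LinearEquiv.coe_coe, TensorProduct.assoc_tmul,
      lTensor_tmul, TensorProduct.assoc_symm_tmul, rTensor_tmul]
    generalize R1 (v ⊗ₜ a1) = t
    induction t using TensorProduct.induction_on with
    | zero => simp
    | add x y hx hy => simp only [map_add, add_tmul, tmul_add, LinearMap.add_apply, hx, hy]
    | tmul a2 v2 => simp [opA]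
  simp only [TensorProduct.assoc_tmul, lTensor_tmul, mul'_apply,
    TensorProduct.assoc_symm_tmul, rTensor_tmul, hN, rC_tmul, opV_tmul, opA_rC]
  simp [rC, mulXC]

end Helpers

/-- for two-sided crossed product data the multiplication
`(a ⊗ v ⊗ c)(a' ⊗ v' ⊗ c') = a (a'_{R3})_{R1} E_A(v_{R1}, v'_{R2}) ⊗ E_V(v_{R1}, v'_{R2})
⊗ E_C(v_{R1}, v'_{R2}) (c_{R3})_{R2} c'` on `A ⊗ V ⊗ C` is associative with unit
`1_A ⊗ 1_V ⊗ 1_C`. -/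
theorem two_sided_crossed_product_is_algebra
    (A V C : Type*) [Ring A] [Algebra k A] [AddCommGroup V] [Module k V]
    [Ring C] [Algebra k C] (e : V) (he : e ≠ 0)
    (R1 : V ⊗[k] A →ₗ[k] A ⊗[k] V) (R2 : C ⊗[k] V →ₗ[k] V ⊗[k] C)
    (R3 : C ⊗[k] A →ₗ[k] A ⊗[k] C) (E : V ⊗[k] V →ₗ[k] (A ⊗[k] V) ⊗[k] C)
    (h : IsTwoSidedData k A V C e R1 R2 R3 E) :
    (∀ x : (A ⊗[k] V) ⊗[k] C,
      tsMul k A V C R1 R2 R3 E ((((1 : A) ⊗ₜ[k] e) ⊗ₜ[k] (1 : C)) ⊗ₜ[k] x) = x) ∧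
    (∀ x : (A ⊗[k] V) ⊗[k] C,
      tsMul k A V C R1 R2 R3 E (x ⊗ₜ[k] (((1 : A) ⊗ₜ[k] e) ⊗ₜ[k] (1 : C))) = x) ∧
    (∀ x y z : (A ⊗[k] V) ⊗[k] C,
      tsMul k A V C R1 R2 R3 E (tsMul k A V C R1 R2 R3 E (x ⊗ₜ[k] y) ⊗ₜ[k] z)
        = tsMul k A V C R1 R2 R3 E (x ⊗ₜ[k] tsMul k A V C R1 R2 R3 E (y ⊗ₜ[k] z))) := by
  simp only [tsMul_eq]
  refine ⟨fun x => ?_, fun x => ?_, fun x y z => ?_⟩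
  · have hV : opV R1 E e = 1 := by
      ext a v c
      simp [h.r1a, h.ea]
    have hC : opC (A := A) R2 R3 1 = 1 := by
      ext a v c
      simp [h.twist.unit_left, h.r2b]
    simp [Lam, hV, hC, opA_one]
  · induction x using TensorProduct.induction_on with
    | zero => simp
    | add x y hx hy => simp only [map_add, LinearMap.add_apply, hx, hy]
    | tmul x c =>
      induction x using TensorProduct.induction_on with
      | zero => simp
      | add x y hx hy => simp only [map_add, add_tmul, LinearMap.add_apply, hx, hy]
      | tmul a v =>
        simp [Lam, h.twist.unit_right, h.r2a, h.r1b, h.eb, opA_one]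
  · rw [Lam_Lam h, Module.End.mul_apply]
end TwoSidedCP
end
end

section
/- Let (A, V, C, R1, R2, R3, E) be two-sided crossed product data over a field k. Define R: (V⊗C)⊗A → A⊗(V⊗C) by R = (R1⊗id_C)∘(id_V⊗R3) and σ: (V⊗C)⊗(V⊗C) → A⊗(V⊗C) by σ = (id_A⊗id_V⊗μ_C)∘(E⊗μ_C)∘(id_V⊗R2⊗id_C), i.e. σ((v⊗c)⊗(v'⊗c')) = E_A(v, v'_{R2}) ⊗ (E_V(v, v'_{R2}) ⊗ E_C(v, v'_{R2}) c_{R2} c'). Then R and σ satisfy the Brzeziński crossed product conditions (brz1)–(brz5) with base algebra A and vector space V⊗C with distinguished element 1_V⊗1_C, so the crossed product A⊗_{R,σ}(V⊗C) exists. -/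
open TensorProduct LinearMap

set_option maxHeartbeats 1000000
set_option synthInstance.maxHeartbeats 400000

noncomputable section

namespace TwoSidedCP

variable (k : Type*) [Field k]

/-!
Overview of the proof. To avoid bookkeeping with associators, every structure map is replaced by a
version acting on the first factors of a right-nested tensor word whose remaining part, the tail,
is an arbitrary vector space. Statements about maps applied in the middle of a word are then
obtained by applying `lTensor` to statements about the beginning of a word. The hypotheses are
translated to this language first, the Brzezinski conditions are derived by rewriting, and finally
the tail is specialised to the ground field in order to return to the original formulation.
-/

section Tail

variable {k}
variable {X Y Z W T T' : Type*}
  [AddCommGroup X] [Module k X] [AddCommGroup Y] [Module k Y]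
  [AddCommGroup Z] [Module k Z] [AddCommGroup W] [Module k W]
  [AddCommGroup T] [Module k T] [AddCommGroup T'] [Module k T']

/-- `f : X ⊗ Y → Z ⊗ W` acting on the first two factors of a right-normed word. -/
def tl (f : X ⊗[k] Y →ₗ[k] Z ⊗[k] W) (T : Type*) [AddCommGroup T] [Module k T] :
    X ⊗[k] (Y ⊗[k] T) →ₗ[k] Z ⊗[k] (W ⊗[k] T) :=
  α k Z W T ∘ₗ rTensor T f ∘ₗ α' k X Y T

/-- `E : X ⊗ X → (Z ⊗ W) ⊗ Y` acting on the first two factors of a right-normed word. -/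
def te (f : X ⊗[k] X →ₗ[k] (Z ⊗[k] W) ⊗[k] Y) (T : Type*) [AddCommGroup T] [Module k T] :
    X ⊗[k] (X ⊗[k] T) →ₗ[k] Z ⊗[k] (W ⊗[k] (Y ⊗[k] T)) :=
  α k Z W (Y ⊗[k] T) ∘ₗ α k (Z ⊗[k] W) Y T ∘ₗ rTensor T f ∘ₗ α' k X X T

/-- multiplication of the first two factors of a right-normed word. -/
def tm (k : Type*) [Field k] (A : Type*) [Ring A] [Algebra k A]
    (T : Type*) [AddCommGroup T] [Module k T] :
    A ⊗[k] (A ⊗[k] T) →ₗ[k] A ⊗[k] T :=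
  rTensor T (mul' k A) ∘ₗ α' k A A T

theorem tl_tmul (f : X ⊗[k] Y →ₗ[k] Z ⊗[k] W) (x : X) (y : Y) (t : T) :
    tl f T (x ⊗ₜ (y ⊗ₜ t)) = α k Z W T (f (x ⊗ₜ y) ⊗ₜ t) := rfl

theorem te_tmul (f : X ⊗[k] X →ₗ[k] (Z ⊗[k] W) ⊗[k] Y) (x y : X) (t : T) :
    te f T (x ⊗ₜ (y ⊗ₜ t)) = α k Z W (Y ⊗[k] T) (α k (Z ⊗[k] W) Y T (f (x ⊗ₜ y) ⊗ₜ t)) := rfl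

theorem tm_tmul {A : Type*} [Ring A] [Algebra k A] (a b : A) (t : T) :
    tm k A T (a ⊗ₜ (b ⊗ₜ t)) = (a * b) ⊗ₜ t := rfl

/-- Naturality of the associator in its last argument, for a fixed tensor `u` in front. -/
theorem alpha_nat (u : X ⊗[k] Y) (g : T →ₗ[k] T') (t : T) :
    α k X Y T' (u ⊗ₜ g t) = lTensor X (lTensor Y g) (α k X Y T (u ⊗ₜ t)) := by
  induction u using TensorProduct.induction_on with
  | zero => simp
  | tmul p q => simp
  | add p q hp hq => simp only [add_tmul, map_add, hp, hq]

/-- Interchange law: a map applied deep in the tail commutes with `tl f`. All such interchange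
laws are oriented so that, read as rewrite rules, inner operations migrate outwards. -/
theorem tl_nat (f : X ⊗[k] Y →ₗ[k] Z ⊗[k] W) (g : T →ₗ[k] T') (x : X ⊗[k] (Y ⊗[k] T)) :
    tl f T' (lTensor X (lTensor Y g) x) = lTensor Z (lTensor W g) (tl f T x) := by
  induction x using TensorProduct.induction_on with
  | zero => simp
  | add p q hp hq => simp only [map_add, hp, hq]
  | tmul x y =>
    induction y using TensorProduct.induction_on with
    | zero => simp
    | add p q hp hq => simp only [tmul_add, map_add, hp, hq]
    | tmul y t => simp only [lTensor_tmul, tl_tmul, alpha_nat]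

/-- Interchange law for the cocycle `te f`, which creates one extra factor in front of the tail. -/
theorem te_nat (f : X ⊗[k] X →ₗ[k] (Z ⊗[k] W) ⊗[k] Y) (g : T →ₗ[k] T')
    (x : X ⊗[k] (X ⊗[k] T)) :
    te f T' (lTensor X (lTensor X g) x) = lTensor Z (lTensor W (lTensor Y g)) (te f T x) := by
  induction x using TensorProduct.induction_on with
  | zero => simp
  | add p q hp hq => simp only [map_add, hp, hq]
  | tmul x y =>
    induction y using TensorProduct.induction_on with
    | zero => simp
    | add p q hp hq => simp only [tmul_add, map_add, hp, hq]
    | tmul y t =>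
      simp only [lTensor_tmul, te_tmul]
      generalize f (x ⊗ₜ y) = u
      induction u using TensorProduct.induction_on with
      | zero => simp
      | add p q hp hq => simp only [add_tmul, map_add, hp, hq]
      | tmul p q =>
        have := alpha_nat p (lTensor Y g) (q ⊗ₜ[k] t)
        simpa using this

/-- Interchange law for multiplication, which consumes one factor. -/
theorem tm_nat {A : Type*} [Ring A] [Algebra k A] (g : T →ₗ[k] T') (x : A ⊗[k] (A ⊗[k] T)) :
    tm k A T' (lTensor A (lTensor A g) x) = lTensor A g (tm k A T x) := by
  induction x using TensorProduct.induction_on with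
  | zero => simp
  | add p q hp hq => simp only [map_add, hp, hq]
  | tmul x y =>
    induction y using TensorProduct.induction_on with
    | zero => simp
    | add p q hp hq => simp only [tmul_add, map_add, hp, hq]
    | tmul y t => simp only [lTensor_tmul, tm_tmul]

/-- Associativity, brought to left-nested normal form. -/
theorem tm_assoc {A : Type*} [Ring A] [Algebra k A] (x : A ⊗[k] (A ⊗[k] (A ⊗[k] T))) :
    tm k A T (lTensor A (tm k A T) x) = tm k A T (tm k A (A ⊗[k] T) x) := by
  induction x using TensorProduct.induction_on with
  | zero => simp
  | add p q hp hq => simp only [map_add, hp, hq]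
  | tmul x y =>
    induction y using TensorProduct.induction_on with
    | zero => simp
    | add p q hp hq => simp only [tmul_add, map_add, hp, hq]
    | tmul y z =>
      induction z using TensorProduct.induction_on with
      | zero => simp
      | add p q hp hq => simp only [tmul_add, map_add, hp, hq]
      | tmul z t => simp only [lTensor_tmul, tm_tmul, mul_assoc]

variable {P Q S U : Type*} [AddCommGroup P] [Module k P] [AddCommGroup Q] [Module k Q]
  [AddCommGroup S] [Module k S] [AddCommGroup U] [Module k U]

/-- A square of linear maps that commutes pointwise still commutes after tensoring with `X`. -/
theorem lift22 {f : P →ₗ[k] Q} {g : S →ₗ[k] P} {h : U →ₗ[k] Q} {l : S →ₗ[k] U}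
    (H : ∀ x, f (g x) = h (l x)) (x : X ⊗[k] S) :
    lTensor X f (lTensor X g x) = lTensor X h (lTensor X l x) := by
  rw [← lTensor_comp_apply, ← lTensor_comp_apply]
  congr 2
  ext x
  exact H x

end Tail

section Rel
variable {k}
variable {A V C : Type*} [Ring A] [Algebra k A] [AddCommGroup V] [Module k V]
  [Ring C] [Algebra k C] {e : V} {R1 : V ⊗[k] A →ₗ[k] A ⊗[k] V}
  {R2 : C ⊗[k] V →ₗ[k] V ⊗[k] C} {R3 : C ⊗[k] A →ₗ[k] A ⊗[k] C}
  {E : V ⊗[k] V →ₗ[k] (A ⊗[k] V) ⊗[k] C}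
  {T : Type*} [AddCommGroup T] [Module k T]

/-- tail form of the left multiplicativity relation, used for `R1` and `R3`. -/
theorem rel_mulL {R : V ⊗[k] A →ₗ[k] A ⊗[k] V}
    (H : R ∘ₗ lTensor V (mul' k A) ∘ₗ α k V A A
      = rTensor V (mul' k A) ∘ₗ α' k A A V ∘ₗ lTensor A R ∘ₗ α k A V A ∘ₗ rTensor A R) :
    tl R T ∘ₗ lTensor V (tm k A T)
      = tm k A (V ⊗[k] T) ∘ₗ lTensor A (tl R T) ∘ₗ tl R (A ⊗[k] T) := by
  ext v a b t
  have H' := LinearMap.congr_fun H ((v ⊗ₜ a) ⊗ₜ b)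
  simp at H'
  simp [tl_tmul, tm_tmul, H']
  generalize R (v ⊗ₜ a) = u
  induction u using TensorProduct.induction_on with
  | zero => simp
  | add p q hp hq => simp only [add_tmul, map_add, hp, hq]
  | tmul p q =>
    simp [tl_tmul]
    generalize R (q ⊗ₜ b) = u
    induction u using TensorProduct.induction_on with
    | zero => simp
    | add p q hp hq => simp only [add_tmul, tmul_add, map_add, hp, hq]
    | tmul p q => simp [tm_tmul]

/-- Mirror image of `rel_mulL`: multiplicativity in the algebra `C` (used for `R2`, `R3`). -/
theorem rel_mulR {R : C ⊗[k] V →ₗ[k] V ⊗[k] C}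
    (H : R ∘ₗ rTensor V (mul' k C)
      = lTensor V (mul' k C) ∘ₗ α k V C C ∘ₗ rTensor C R ∘ₗ α' k C V C ∘ₗ lTensor C R
        ∘ₗ α k C C V) :
    tl R T ∘ₗ tm k C (V ⊗[k] T)
      = lTensor V (tm k C T) ∘ₗ tl R (C ⊗[k] T) ∘ₗ lTensor C (tl R T) := by
  ext v a b t
  have H' := LinearMap.congr_fun H ((v ⊗ₜ a) ⊗ₜ b)
  simp at H'
  simp [tl_tmul, tm_tmul, H']
  generalize R (a ⊗ₜ b) = u
  induction u using TensorProduct.induction_on with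
  | zero => simp
  | add p q hp hq => simp only [add_tmul, tmul_add, map_add, hp, hq]
  | tmul p q =>
    simp [tl_tmul]
    generalize R (v ⊗ₜ p) = u
    induction u using TensorProduct.induction_on with
    | zero => simp
    | add p q hp hq => simp only [add_tmul, tmul_add, map_add, hp, hq]
    | tmul p q => simp [tm_tmul]

/-- Hexagon (Yang-Baxter type) compatibility `eq3` between the three exchange maps, with tails. -/
theorem rel3 (h : IsTwoSidedData k A V C e R1 R2 R3 E) :
    lTensor A (tl R2 T) ∘ₗ tl R3 (V ⊗[k] T) ∘ₗ lTensor C (tl R1 T)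
      = tl R1 (C ⊗[k] T) ∘ₗ lTensor V (tl R3 T) ∘ₗ tl R2 (A ⊗[k] T) := by
  ext c v a t
  have H' := LinearMap.congr_fun h.eq3 (c ⊗ₜ (v ⊗ₜ a))
  simp at H'
  have HL : ∀ u : A ⊗[k] V, (lTensor A (tl R2 T) ∘ₗ tl R3 (V ⊗[k] T)) (c ⊗ₜ α k A V T (u ⊗ₜ t))
      = lTensor A (α k V C T) (α k A (V ⊗[k] C) T
        ((lTensor A R2 (α k A C V (rTensor V R3 (α' k C A V (c ⊗ₜ u))))) ⊗ₜ t)) := by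
    intro u
    induction u using TensorProduct.induction_on with
    | zero => simp
    | add p q hp hq => simp only [add_tmul, tmul_add, map_add, hp, hq]
    | tmul p q =>
      simp [tl_tmul]
      generalize R3 (c ⊗ₜ p) = u
      induction u using TensorProduct.induction_on with
      | zero => simp
      | add p q hp hq => simp only [add_tmul, tmul_add, map_add, hp, hq]
      | tmul p q => simp [tl_tmul]
  have HR : ∀ u : V ⊗[k] C,
      (tl R1 (C ⊗[k] T) ∘ₗ lTensor V (tl R3 T)) (α k V C (A ⊗[k] T) (u ⊗ₜ (a ⊗ₜ t)))
      = lTensor A (α k V C T) (α k A (V ⊗[k] C) T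
        ((α k A V C (rTensor C R1 (α' k V A C (lTensor V R3 (α k V C A (u ⊗ₜ a)))))) ⊗ₜ t)) := by
    intro u
    induction u using TensorProduct.induction_on with
    | zero => simp
    | add p q hp hq => simp only [add_tmul, tmul_add, map_add, hp, hq]
    | tmul p q =>
      simp [tl_tmul]
      generalize R3 (q ⊗ₜ a) = u
      induction u using TensorProduct.induction_on with
      | zero => simp
      | add p q hp hq => simp only [add_tmul, tmul_add, map_add, hp, hq]
      | tmul y z =>
        simp [tl_tmul]
        generalize R1 (p ⊗ₜ y) = u
        induction u using TensorProduct.induction_on with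
        | zero => simp
        | add p q hp hq => simp only [add_tmul, tmul_add, map_add, hp, hq]
        | tmul p q => simp
  have h1 := HL (R1 (v ⊗ₜ a))
  have h2 := HR (R2 (c ⊗ₜ v))
  simp at h1 h2
  simp [tl_tmul, h1, h2, H']

/-- Equation `eq4`: how `E` interacts with moving an element of `A` to the left past both inputs. -/
theorem rel4 (h : IsTwoSidedData k A V C e R1 R2 R3 E) :
    tm k A _ ∘ₗ lTensor A (te E T) ∘ₗ tl R1 (V ⊗[k] T) ∘ₗ lTensor V (tl R1 T)
      = tm k A _ ∘ₗ lTensor A (tl R1 (C ⊗[k] T)) ∘ₗ lTensor A (lTensor V (tl R3 T))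
        ∘ₗ te E (A ⊗[k] T) := by
  ext v w a t
  have H' := LinearMap.congr_fun h.eq4 ((v ⊗ₜ w) ⊗ₜ a)
  simp at H'
  have HL : ∀ u : A ⊗[k] V,
      (tm k A _ ∘ₗ lTensor A (te E T) ∘ₗ tl R1 (V ⊗[k] T)) (v ⊗ₜ α k A V T (u ⊗ₜ t))
      = α k A V _ (α k (A ⊗[k] V) C T
        ((rTensor C (mulAV k A V) (α' k A (A ⊗[k] V) C (lTensor A E (α k A V V
          (rTensor V R1 (α' k V A V (v ⊗ₜ u))))))) ⊗ₜ t)) := by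
    intro u
    induction u using TensorProduct.induction_on with
    | zero => simp
    | add p q hp hq => simp only [add_tmul, tmul_add, map_add, hp, hq]
    | tmul p q =>
      simp [tl_tmul]
      generalize R1 (v ⊗ₜ p) = u
      induction u using TensorProduct.induction_on with
      | zero => simp
      | add p q hp hq => simp only [add_tmul, tmul_add, map_add, hp, hq]
      | tmul y z =>
        simp [te_tmul]
        generalize E (z ⊗ₜ q) = u
        induction u using TensorProduct.induction_on with
        | zero => simp
        | add p q hp hq => simp only [add_tmul, tmul_add, map_add, hp, hq]
        | tmul u c =>
          induction u using TensorProduct.induction_on with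
          | zero => simp
          | add p q hp hq => simp only [add_tmul, tmul_add, map_add, hp, hq]
          | tmul p q => simp [mulAV, tm_tmul]
  have HR : ∀ u : (A ⊗[k] V) ⊗[k] C,
      (tm k A _ ∘ₗ lTensor A (tl R1 (C ⊗[k] T)) ∘ₗ lTensor A (lTensor V (tl R3 T)))
        (α k A V _ (α k (A ⊗[k] V) C _ (u ⊗ₜ (a ⊗ₜ t))))
      = α k A V _ (α k (A ⊗[k] V) C T
        ((rTensor C (mulAV k A V) (rTensor C (lTensor A R1) (rTensor C (α k A V A)
        (α' k (A ⊗[k] V) A C (lTensor (A ⊗[k] V) R3 (α k (A ⊗[k] V) C A (u ⊗ₜ a))))))) ⊗ₜ t)) := by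
    intro u
    induction u using TensorProduct.induction_on with
    | zero => simp
    | add p q hp hq => simp only [add_tmul, tmul_add, map_add, hp, hq]
    | tmul u c =>
      induction u using TensorProduct.induction_on with
      | zero => simp
      | add p q hp hq => simp only [add_tmul, tmul_add, map_add, hp, hq]
      | tmul p q =>
      simp [tl_tmul]
      generalize R3 (c ⊗ₜ a) = u
      induction u using TensorProduct.induction_on with
      | zero => simp
      | add p q hp hq => simp only [add_tmul, tmul_add, map_add, hp, hq]
      | tmul y z =>
        simp [tl_tmul]
        generalize R1 (q ⊗ₜ y) = u
        induction u using TensorProduct.induction_on with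
        | zero => simp
        | add p q hp hq => simp only [add_tmul, tmul_add, map_add, hp, hq]
        | tmul p q => simp [mulAV, tm_tmul]
  have h1 := HL (R1 (w ⊗ₜ a))
  have h2 := HR (E (v ⊗ₜ w))
  simp at h1 h2
  simp [tl_tmul, te_tmul, h1, h2, H']

/-- Equation `eq5`: how `E` interacts with moving an element of `C` to the right past both inputs. -/
theorem rel5 (h : IsTwoSidedData k A V C e R1 R2 R3 E) :
    lTensor A (lTensor V (tm k C T)) ∘ₗ te E (C ⊗[k] T) ∘ₗ lTensor V (tl R2 T)
        ∘ₗ tl R2 (V ⊗[k] T)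
      = lTensor A (lTensor V (tm k C T)) ∘ₗ lTensor A (tl R2 (C ⊗[k] T)) ∘ₗ tl R3 _
        ∘ₗ lTensor C (te E T) := by
  ext c v w t
  have H' := LinearMap.congr_fun h.eq5 ((c ⊗ₜ v) ⊗ₜ w)
  simp at H'
  have HL : ∀ u : V ⊗[k] C,
      (lTensor A (lTensor V (tm k C T)) ∘ₗ te E (C ⊗[k] T) ∘ₗ lTensor V (tl R2 T))
        (α k V C _ (u ⊗ₜ (w ⊗ₜ t)))
      = α k A V _ (α k (A ⊗[k] V) C T
        ((mulXC k (A ⊗[k] V) C (rTensor C E (α' k V V C (lTensor V R2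
          (α k V C V (u ⊗ₜ w)))))) ⊗ₜ t)) := by
    intro u
    induction u using TensorProduct.induction_on with
    | zero => simp
    | add p q hp hq => simp only [add_tmul, tmul_add, map_add, hp, hq]
    | tmul p q =>
      simp [tl_tmul]
      generalize R2 (q ⊗ₜ w) = u
      induction u using TensorProduct.induction_on with
      | zero => simp
      | add p q hp hq => simp only [add_tmul, tmul_add, map_add, hp, hq]
      | tmul y z =>
        simp [te_tmul]
        generalize E (p ⊗ₜ y) = u
        induction u using TensorProduct.induction_on with
        | zero => simp
        | add p q hp hq => simp only [add_tmul, tmul_add, map_add, hp, hq]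
        | tmul u c =>
          induction u using TensorProduct.induction_on with
          | zero => simp
          | add p q hp hq => simp only [add_tmul, tmul_add, map_add, hp, hq]
          | tmul p q => simp [mulXC, tm_tmul]
  have HR : ∀ u : (A ⊗[k] V) ⊗[k] C,
      (lTensor A (lTensor V (tm k C T)) ∘ₗ lTensor A (tl R2 (C ⊗[k] T)) ∘ₗ tl R3 _)
        (c ⊗ₜ (α k A V _ (α k (A ⊗[k] V) C _ (u ⊗ₜ t))))
      = α k A V _ (α k (A ⊗[k] V) C T
        ((mulXC k (A ⊗[k] V) C (rTensor C (α' k A V C) (rTensor C (lTensor A R2)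
        (rTensor C (α k A C V) (rTensor C (rTensor V R3) (rTensor C (α' k C A V)
        (α' k C (A ⊗[k] V) C (c ⊗ₜ u)))))))) ⊗ₜ t)) := by
    intro u
    induction u using TensorProduct.induction_on with
    | zero => simp
    | add p q hp hq => simp only [add_tmul, tmul_add, map_add, hp, hq]
    | tmul u c' =>
      induction u using TensorProduct.induction_on with
      | zero => simp
      | add p q hp hq => simp only [add_tmul, tmul_add, map_add, hp, hq]
      | tmul p q =>
      simp [tl_tmul]
      generalize R3 (c ⊗ₜ p) = u
      induction u using TensorProduct.induction_on with
      | zero => simp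
      | add p q hp hq => simp only [add_tmul, tmul_add, map_add, hp, hq]
      | tmul y z =>
        simp [tl_tmul]
        generalize R2 (z ⊗ₜ q) = u
        induction u using TensorProduct.induction_on with
        | zero => simp
        | add p q hp hq => simp only [add_tmul, tmul_add, map_add, hp, hq]
        | tmul p q => simp [mulXC, tm_tmul]
  have h1 := HL (R2 (c ⊗ₜ v))
  have h2 := HR (E (v ⊗ₜ w))
  simp at h1 h2
  simp [tl_tmul, te_tmul, h1, h2, H']

/-- Twisted 2-cocycle identity `eq6` with tails. Here `HE` evaluates the common outer part. -/
theorem rel6 (h : IsTwoSidedData k A V C e R1 R2 R3 E) :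
    lTensor A (lTensor V (tm k C T)) ∘ₗ tm k A _ ∘ₗ lTensor A (te E (C ⊗[k] T)) ∘ₗ tl R1 _
        ∘ₗ lTensor V (te E T)
      = lTensor A (lTensor V (tm k C T)) ∘ₗ tm k A _ ∘ₗ lTensor A (te E (C ⊗[k] T))
        ∘ₗ lTensor A (lTensor V (tl R2 T)) ∘ₗ te E _ := by
  ext v w x t
  have H' := LinearMap.congr_fun h.eq6 ((v ⊗ₜ w) ⊗ₜ x)
  simp at H'
  have HE : ∀ (a : A) (c : C) (u : (A ⊗[k] V) ⊗[k] C),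
      lTensor A (lTensor V (tm k C T)) (tm k A _
        (a ⊗ₜ (α k A V _ (α k (A ⊗[k] V) C _ (u ⊗ₜ (c ⊗ₜ t))))))
      = α k A V _ (α k (A ⊗[k] V) C T ((tsTail k A V C ((a ⊗ₜ u) ⊗ₜ c)) ⊗ₜ t)) := by
    intro a c u
    induction u using TensorProduct.induction_on with
    | zero => simp
    | add p q hp hq => simp only [add_tmul, tmul_add, map_add, hp, hq]
    | tmul u c =>
      induction u using TensorProduct.induction_on with
      | zero => simp
      | add p q hp hq => simp only [add_tmul, tmul_add, map_add, hp, hq]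
      | tmul p q => simp [mulXC, mulAV, tsTail, tm_tmul]
  have HL : ∀ u : (A ⊗[k] V) ⊗[k] C,
      (lTensor A (lTensor V (tm k C T)) ∘ₗ tm k A _ ∘ₗ lTensor A (te E (C ⊗[k] T)) ∘ₗ tl R1 _)
        (v ⊗ₜ (α k A V _ (α k (A ⊗[k] V) C _ (u ⊗ₜ t))))
      = α k A V _ (α k (A ⊗[k] V) C T
        ((tsTail k A V C (rTensor C (lTensor A E) (rTensor C (α k A V V)
        (rTensor C (rTensor V R1) (rTensor C (α' k V A V)
        (α' k V (A ⊗[k] V) C (v ⊗ₜ u))))))) ⊗ₜ t)) := by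
    intro u
    induction u using TensorProduct.induction_on with
    | zero => simp
    | add p q hp hq => simp only [add_tmul, tmul_add, map_add, hp, hq]
    | tmul u c' =>
      induction u using TensorProduct.induction_on with
      | zero => simp
      | add p q hp hq => simp only [add_tmul, tmul_add, map_add, hp, hq]
      | tmul p q =>
      simp [tl_tmul]
      generalize R1 (v ⊗ₜ p) = u
      induction u using TensorProduct.induction_on with
      | zero => simp
      | add p q hp hq => simp only [add_tmul, tmul_add, map_add, hp, hq]
      | tmul y z =>
        have := HE y c' (E (z ⊗ₜ q))
        simp at this
        simp [te_tmul, this]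
  have HR : ∀ u : (A ⊗[k] V) ⊗[k] C,
      (lTensor A (lTensor V (tm k C T)) ∘ₗ tm k A _ ∘ₗ lTensor A (te E (C ⊗[k] T))
        ∘ₗ lTensor A (lTensor V (tl R2 T)))
        (α k A V _ (α k (A ⊗[k] V) C _ (u ⊗ₜ (x ⊗ₜ t))))
      = α k A V _ (α k (A ⊗[k] V) C T
        ((tsTail k A V C (rTensor C (lTensor A E) (rTensor C (α k A V V)
        (α' k (A ⊗[k] V) V C (lTensor (A ⊗[k] V) R2 (α k (A ⊗[k] V) C V (u ⊗ₜ x))))))) ⊗ₜ t)) := by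
    intro u
    induction u using TensorProduct.induction_on with
    | zero => simp
    | add p q hp hq => simp only [add_tmul, tmul_add, map_add, hp, hq]
    | tmul u c =>
      induction u using TensorProduct.induction_on with
      | zero => simp
      | add p q hp hq => simp only [add_tmul, tmul_add, map_add, hp, hq]
      | tmul p q =>
      simp [tl_tmul]
      generalize R2 (c ⊗ₜ x) = u
      induction u using TensorProduct.induction_on with
      | zero => simp
      | add p q hp hq => simp only [add_tmul, tmul_add, map_add, hp, hq]
      | tmul y z =>
        have := HE p z (E (q ⊗ₜ y))
        simp at this
        simp [te_tmul, this]
  have h1 := HL (E (w ⊗ₜ x))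
  have h2 := HR (E (v ⊗ₜ w))
  simp at h1 h2
  simp [te_tmul, h1, h2, H']

end Rel

section Lifts
variable {k}
variable {X Y Z W T T' M N O : Type*}
  [AddCommGroup X] [Module k X] [AddCommGroup Y] [Module k Y]
  [AddCommGroup Z] [Module k Z] [AddCommGroup W] [Module k W]
  [AddCommGroup T] [Module k T] [AddCommGroup T'] [Module k T']
  [AddCommGroup M] [Module k M] [AddCommGroup N] [Module k N] [AddCommGroup O] [Module k O]

theorem tl_nat1 (f : X ⊗[k] Y →ₗ[k] Z ⊗[k] W) (g : T →ₗ[k] T') (x : M ⊗[k] _) :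
    lTensor M (tl f T') (lTensor M (lTensor X (lTensor Y g)) x)
      = lTensor M (lTensor Z (lTensor W g)) (lTensor M (tl f T) x) :=
  lift22 (tl_nat f g) x

theorem tl_nat2 (f : X ⊗[k] Y →ₗ[k] Z ⊗[k] W) (g : T →ₗ[k] T') (x : N ⊗[k] (M ⊗[k] _)) :
    lTensor N (lTensor M (tl f T')) (lTensor N (lTensor M (lTensor X (lTensor Y g))) x)
      = lTensor N (lTensor M (lTensor Z (lTensor W g))) (lTensor N (lTensor M (tl f T)) x) :=
  lift22 (tl_nat1 f g) x

theorem te_nat1 (f : X ⊗[k] X →ₗ[k] (Z ⊗[k] W) ⊗[k] Y) (g : T →ₗ[k] T') (x : M ⊗[k] _) :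
    lTensor M (te f T') (lTensor M (lTensor X (lTensor X g)) x)
      = lTensor M (lTensor Z (lTensor W (lTensor Y g))) (lTensor M (te f T) x) :=
  lift22 (te_nat f g) x

variable {A : Type*} [Ring A] [Algebra k A]

theorem tm_nat2 (g : T →ₗ[k] T') (x : N ⊗[k] (M ⊗[k] (A ⊗[k] (A ⊗[k] T)))) :
    lTensor N (lTensor M (tm k A T')) (lTensor N (lTensor M (lTensor A (lTensor A g))) x)
      = lTensor N (lTensor M (lTensor A g)) (lTensor N (lTensor M (tm k A T)) x) :=
  lift22 (lift22 (tm_nat g)) x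

theorem tm_assoc2 (x : N ⊗[k] (M ⊗[k] (A ⊗[k] (A ⊗[k] (A ⊗[k] T))))) :
    lTensor N (lTensor M (tm k A T)) (lTensor N (lTensor M (lTensor A (tm k A T))) x)
      = lTensor N (lTensor M (tm k A T)) (lTensor N (lTensor M (tm k A (A ⊗[k] T))) x) :=
  lift22 (lift22 tm_assoc) x

theorem tm_assoc3 (x : O ⊗[k] (N ⊗[k] (M ⊗[k] (A ⊗[k] (A ⊗[k] (A ⊗[k] T)))))) :
    lTensor O (lTensor N (lTensor M (tm k A T)))
        (lTensor O (lTensor N (lTensor M (lTensor A (tm k A T)))) x)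
      = lTensor O (lTensor N (lTensor M (tm k A T)))
        (lTensor O (lTensor N (lTensor M (tm k A (A ⊗[k] T)))) x) :=
  lift22 tm_assoc2 x

end Lifts

section Brz
variable {k}
variable {A V C : Type*} [Ring A] [Algebra k A] [AddCommGroup V] [Module k V]
  [Ring C] [Algebra k C] {e : V} {R1 : V ⊗[k] A →ₗ[k] A ⊗[k] V}
  {R2 : C ⊗[k] V →ₗ[k] V ⊗[k] C} {R3 : C ⊗[k] A →ₗ[k] A ⊗[k] C}
  {E : V ⊗[k] V →ₗ[k] (A ⊗[k] V) ⊗[k] C}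
  {T : Type*} [AddCommGroup T] [Module k T]

/-- tail form of `tsR`. -/
def tR (R1 : V ⊗[k] A →ₗ[k] A ⊗[k] V) (R3 : C ⊗[k] A →ₗ[k] A ⊗[k] C)
    (T : Type*) [AddCommGroup T] [Module k T] :
    V ⊗[k] (C ⊗[k] (A ⊗[k] T)) →ₗ[k] A ⊗[k] (V ⊗[k] (C ⊗[k] T)) :=
  tl R1 (C ⊗[k] T) ∘ₗ lTensor V (tl R3 T)

/-- tail form of `tsSigma`. -/
def tS (R2 : C ⊗[k] V →ₗ[k] V ⊗[k] C) (E : V ⊗[k] V →ₗ[k] (A ⊗[k] V) ⊗[k] C)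
    (T : Type*) [AddCommGroup T] [Module k T] :
    V ⊗[k] (C ⊗[k] (V ⊗[k] (C ⊗[k] T))) →ₗ[k] A ⊗[k] (V ⊗[k] (C ⊗[k] T)) :=
  lTensor A (lTensor V (tm k C T)) ∘ₗ te E (C ⊗[k] T) ∘ₗ lTensor V (lTensor V (tm k C T))
    ∘ₗ lTensor V (tl R2 (C ⊗[k] T))

/-- Condition (brz3) in tail form: multiplicativity of `R3` followed by that of `R1`. -/
theorem tail3 (h : IsTwoSidedData k A V C e R1 R2 R3 E) (x) :
    tR R1 R3 T (lTensor V (lTensor C (tm k A T)) x)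
      = tm k A _ (lTensor A (tR R1 R3 T) (tR R1 R3 (A ⊗[k] T) x)) := by
  have q1 := fun y => LinearMap.congr_fun
    (congrArg (lTensor V) (rel_mulL (T := T) h.twist.mul_left)) y
  have q2 := fun y => LinearMap.congr_fun (rel_mulL (T := C ⊗[k] T) h.eq1) y
  simp only [lTensor_comp, comp_apply] at q1 q2
  simp only [tR, lTensor_comp, comp_apply, q1, q2, tl_nat]

/-- Condition (brz5) in tail form. On the right, `R3` is distributed over the two products in `C`;
what is left follows from `eq4` and then the hexagon `eq3`. -/
theorem tail5 (h : IsTwoSidedData k A V C e R1 R2 R3 E) (x) :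
    tm k A _ (lTensor A (tS R2 E T) (tR R1 R3 _ (lTensor V (lTensor C (tR R1 R3 T)) x)))
      = tm k A _ (lTensor A (tR R1 R3 T) (tS R2 E (A ⊗[k] T) x)) := by
  have q1 := fun y => LinearMap.congr_fun
    (congrArg (lTensor A) (congrArg (lTensor V) (rel_mulR (T := T) h.twist.mul_right))) y
  have q2 := fun y => LinearMap.congr_fun
    (congrArg (lTensor A) (congrArg (lTensor V) (congrArg (lTensor C)
      (rel_mulR (T := T) h.twist.mul_right)))) y
  have q3 := fun y => LinearMap.congr_fun (congrArg (lTensor V) (rel3 (T := C ⊗[k] T) h)) y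
  have q4 := fun y => LinearMap.congr_fun (rel4 (T := C ⊗[k] (C ⊗[k] T)) h) y
  simp only [lTensor_comp, comp_apply] at q1 q2 q3 q4
  simp only [tR, tS, lTensor_comp, comp_apply, te_nat, tm_nat, te_nat1]
  simp only [q1, q2, tl_nat1, tl_nat2, tm_nat]
  rw [← te_nat E (lTensor C (tl R3 T)), ← te_nat E (tl R3 _), ← q4, ← tl_nat1, ← q3, tl_nat]

/-- Condition (brz4) in tail form. On the left, `eq5` and then `eq6` apply; on the right, `R2` is
distributed over products in `C`; both sides then agree up to associativity and interchange. -/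
theorem tail4 (h : IsTwoSidedData k A V C e R1 R2 R3 E) (x) :
    tm k A _ (lTensor A (tS R2 E T) (tR R1 R3 _ (lTensor V (lTensor C (tS R2 E T)) x)))
      = tm k A _ (lTensor A (tS R2 E T) (tS R2 E _ x)) := by
  have q1 := fun y => LinearMap.congr_fun
    (congrArg (lTensor A) (congrArg (lTensor V) (rel_mulR (T := C ⊗[k] T) h.eq2))) y
  have q2 := fun y => LinearMap.congr_fun
    (congrArg (lTensor A) (congrArg (lTensor V) (congrArg (lTensor C)
      (rel_mulR (T := C ⊗[k] T) h.eq2)))) y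
  have q5 := fun y => LinearMap.congr_fun (congrArg (lTensor V) (rel5 (T := C ⊗[k] T) h)) y
  have q6 := fun y => LinearMap.congr_fun (rel6 (T := C ⊗[k] (C ⊗[k] T)) h) y
  simp only [lTensor_comp, comp_apply] at q1 q2 q5 q6
  simp only [tR, tS, lTensor_comp, comp_apply]
  -- right-hand side: pull all multiplications of `C` to the outside
  simp only [te_nat, q1, q2, tl_nat2]
  -- left-hand side
  rw [tl_nat1, tl_nat, tl_nat2, tm_assoc3, ← tl_nat R1 (tl R2 _), ← tl_nat R1 (lTensor V (tm k C _)),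
    ← q5, tl_nat R1 (lTensor V (tm k C _))]
  simp only [te_nat1, tm_nat, tm_assoc2, tm_assoc3]
  rw [q6]
  simp only [te_nat, te_nat1, tl_nat1, tl_nat2, tm_nat, tm_nat2, tm_assoc2, tm_assoc3]

variable (k A V C) in
/-- Attach a tail to an element of `A ⊗ (V ⊗ C)`. -/
def beta (T : Type*) [AddCommGroup T] [Module k T] (z : A ⊗[k] (V ⊗[k] C)) (t : T) :
    A ⊗[k] (V ⊗[k] (C ⊗[k] T)) :=
  lTensor A (α k V C T) (α k A (V ⊗[k] C) T (z ⊗ₜ t))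

theorem beta_zero (t : T) : beta k A V C T 0 t = 0 := by simp [beta]

theorem beta_add (x y) (t : T) :
    beta k A V C T (x + y) t = beta k A V C T x t + beta k A V C T y t := by
  simp only [beta, add_tmul, map_add]

theorem beta_tmul (a : A) (v : V) (c : C) (t : T) :
    beta k A V C T (a ⊗ₜ (v ⊗ₜ c)) t = a ⊗ₜ (v ⊗ₜ (c ⊗ₜ t)) := rfl

/-- Nothing is lost by adjoining the trivial tail `1 : k`, because `C ⊗ k` is just `C`. -/
theorem beta_inj (x y) (H : beta k A V C k x 1 = beta k A V C k y 1) : x = y := by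
  have key : ∀ z, lTensor A (lTensor V (TensorProduct.rid k C).toLinearMap)
      (beta k A V C k z 1) = z := by
    intro z
    induction z using TensorProduct.induction_on with
    | zero => simp [beta_zero]
    | add p q hp hq => simp only [beta_add, map_add, hp, hq]
    | tmul a w =>
      induction w using TensorProduct.induction_on with
      | zero => simp [beta_zero]
      | add p q hp hq => simp only [tmul_add, beta_add, map_add, hp, hq]
      | tmul v c => simp [beta_tmul]
  rw [← key x, H, key y]

/-- Multiplying by `p : A` from the left is compatible with adjoining a tail. -/
theorem tm_beta (p : A) (z) (t : T) :
    tm k A _ (p ⊗ₜ beta k A V C T z t)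
      = beta k A V C T (rTensor (V ⊗[k] C) (mul' k A) (α' k A A (V ⊗[k] C) (p ⊗ₜ z))) t := by
  induction z using TensorProduct.induction_on with
  | zero => simp [beta_zero]
  | add p q hp hq => simp only [beta_add, tmul_add, map_add, hp, hq]
  | tmul a w =>
    induction w using TensorProduct.induction_on with
    | zero => simp [beta_zero]
    | add p q hp hq => simp only [tmul_add, beta_add, map_add, hp, hq]
    | tmul v c => simp [beta_tmul, tm_tmul]

/-- Comparison of `tR` with the frozen definition `tsR` on pure tensors. -/
theorem tR_tmul (v : V) (c : C) (a : A) (t : T) :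
    tR R1 R3 T (v ⊗ₜ (c ⊗ₜ (a ⊗ₜ t)))
      = beta k A V C T (tsR k A V C R1 R3 ((v ⊗ₜ c) ⊗ₜ a)) t := by
  simp [tR, tsR, tl_tmul]
  generalize R3 (c ⊗ₜ a) = u
  induction u using TensorProduct.induction_on with
  | zero => simp [beta_zero]
  | add p q hp hq => simp only [add_tmul, tmul_add, map_add, hp, hq, beta_add]
  | tmul p q =>
    simp [tl_tmul]
    generalize R1 (v ⊗ₜ p) = u
    induction u using TensorProduct.induction_on with
    | zero => simp [beta_zero]
    | add p q hp hq => simp only [add_tmul, tmul_add, map_add, hp, hq, beta_add]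
    | tmul p q => simp [beta_tmul]

/-- Comparison of `tS` with the frozen definition `tsSigma` on pure tensors. -/
theorem tS_tmul (v : V) (c : C) (v' : V) (c' : C) (t : T) :
    tS R2 E T (v ⊗ₜ (c ⊗ₜ (v' ⊗ₜ (c' ⊗ₜ t))))
      = beta k A V C T (tsSigma k A V C R2 E ((v ⊗ₜ c) ⊗ₜ (v' ⊗ₜ c'))) t := by
  simp [tS, tsSigma, tl_tmul]
  generalize R2 (c ⊗ₜ v') = u
  induction u using TensorProduct.induction_on with
  | zero => simp [beta_zero]
  | add p q hp hq => simp only [add_tmul, tmul_add, map_add, hp, hq, beta_add]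
  | tmul p q =>
    simp [te_tmul, tm_tmul]
    generalize E (v ⊗ₜ p) = u
    induction u using TensorProduct.induction_on with
    | zero => simp [beta_zero]
    | add p q hp hq => simp only [add_tmul, tmul_add, map_add, hp, hq, beta_add]
    | tmul u d =>
      induction u using TensorProduct.induction_on with
      | zero => simp [beta_zero]
      | add p q hp hq => simp only [add_tmul, tmul_add, map_add, hp, hq, beta_add]
      | tmul p q => simp [beta_tmul, mulXC, tm_tmul]

/-- `m ∘ (A ⊗ R)` with tails -/
theorem outR (z) (a : A) (t : T) :
    tm k A _ (lTensor A (tR R1 R3 T) (beta k A V C _ z (a ⊗ₜ t)))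
      = beta k A V C T (rTensor (V ⊗[k] C) (mul' k A) (α' k A A (V ⊗[k] C)
        (lTensor A (tsR k A V C R1 R3) (α k A (V ⊗[k] C) A (z ⊗ₜ a))))) t := by
  induction z using TensorProduct.induction_on with
  | zero => simp [beta_zero]
  | add p q hp hq => simp only [beta_add, add_tmul, tmul_add, map_add, hp, hq]
  | tmul p w =>
    induction w using TensorProduct.induction_on with
    | zero => simp [beta_zero]
    | add p q hp hq => simp only [add_tmul, tmul_add, beta_add, map_add, hp, hq]
    | tmul v c =>
      rw [beta_tmul, lTensor_tmul, tR_tmul, tm_beta]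
      simp

/-- The outer operation `m ∘ (A ⊗ σ)` with tails, common to both sides of (brz4). -/
theorem outS (z) (v : V) (c : C) (t : T) :
    tm k A _ (lTensor A (tS R2 E T) (beta k A V C _ z (v ⊗ₜ (c ⊗ₜ t))))
      = beta k A V C T (rTensor (V ⊗[k] C) (mul' k A) (α' k A A (V ⊗[k] C)
        (lTensor A (tsSigma k A V C R2 E)
          (α k A (V ⊗[k] C) (V ⊗[k] C) (z ⊗ₜ (v ⊗ₜ c)))))) t := by
  induction z using TensorProduct.induction_on with
  | zero => simp [beta_zero]
  | add p q hp hq => simp only [beta_add, add_tmul, tmul_add, map_add, hp, hq]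
  | tmul p w =>
    induction w using TensorProduct.induction_on with
    | zero => simp [beta_zero]
    | add p q hp hq => simp only [add_tmul, tmul_add, beta_add, map_add, hp, hq]
    | tmul v c =>
      rw [beta_tmul, lTensor_tmul, tS_tmul, tm_beta]
      simp

/-- The composite of `R`, then `σ`, then the product of `A`: left-hand sides of (brz4) and (brz5). -/
theorem outRS (z) (v : V) (c : C) (t : T) :
    tm k A _ (lTensor A (tS R2 E T) (tR R1 R3 _ (v ⊗ₜ (c ⊗ₜ beta k A V C T z t))))
      = beta k A V C T (rTensor (V ⊗[k] C) (mul' k A) (α' k A A (V ⊗[k] C)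
        (lTensor A (tsSigma k A V C R2 E) (α k A (V ⊗[k] C) (V ⊗[k] C)
          (rTensor (V ⊗[k] C) (tsR k A V C R1 R3) (α' k (V ⊗[k] C) A (V ⊗[k] C)
            ((v ⊗ₜ c) ⊗ₜ z))))))) t := by
  induction z using TensorProduct.induction_on with
  | zero => simp [beta_zero]
  | add p q hp hq => simp only [beta_add, add_tmul, tmul_add, map_add, hp, hq]
  | tmul p w =>
    induction w using TensorProduct.induction_on with
    | zero => simp [beta_zero]
    | add p q hp hq => simp only [add_tmul, tmul_add, beta_add, map_add, hp, hq]
    | tmul v' c' =>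
      rw [beta_tmul, tR_tmul, outS]
      simp

end Brz

/-- `R = (R1 ⊗ id_C)∘(id_V ⊗ R3)` and
`σ((v ⊗ c) ⊗ (v' ⊗ c')) = E_A(v, v'_{R2}) ⊗ (E_V(v, v'_{R2}) ⊗ E_C(v, v'_{R2}) c_{R2} c')`
satisfy the Brzeziński conditions (brz1)-(brz5) for base algebra `A` and the vector
space `V ⊗ C` with distinguished element `1_V ⊗ 1_C`. -/
theorem two_sided_data_gives_brzezinski_data
    (A V C : Type*) [Ring A] [Algebra k A] [AddCommGroup V] [Module k V]
    [Ring C] [Algebra k C] (e : V) (he : e ≠ 0)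
    (R1 : V ⊗[k] A →ₗ[k] A ⊗[k] V) (R2 : C ⊗[k] V →ₗ[k] V ⊗[k] C)
    (R3 : C ⊗[k] A →ₗ[k] A ⊗[k] C) (E : V ⊗[k] V →ₗ[k] (A ⊗[k] V) ⊗[k] C)
    (h : IsTwoSidedData k A V C e R1 R2 R3 E) :
    IsBrzData k A (V ⊗[k] C) (e ⊗ₜ[k] (1 : C)) (tsR k A V C R1 R3)
      (tsSigma k A V C R2 E) := by
  have t3 := fun x => tail3 (T := k) h x
  have t4 := fun x => tail4 (T := k) h x
  have t5 := fun x => tail5 (T := k) h x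
  refine ⟨?_, ?_, ?_, ?_, ?_, ?_, ?_⟩
  · intro a
    simp [tsR, h.twist.unit_left, h.r1a]
  · intro w
    induction w using TensorProduct.induction_on with
    | zero => simp
    | add p q hp hq => simp only [add_tmul, tmul_add, map_add, hp, hq]
    | tmul v c => simp [tsR, h.twist.unit_right, h.r1b]
  · intro w
    induction w using TensorProduct.induction_on with
    | zero => simp
    | add p q hp hq => simp only [tmul_add, map_add, hp, hq]
    | tmul v c => simp [tsSigma, mulXC, h.r2b, h.ea]
  · intro w
    induction w using TensorProduct.induction_on with
    | zero => simp
    | add p q hp hq => simp only [add_tmul, tmul_add, map_add, hp, hq]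
    | tmul v c => simp [tsSigma, mulXC, h.r2a, h.eb]
  · refine TensorProduct.ext_threefold fun w a b => ?_
    induction w using TensorProduct.induction_on with
    | zero => simp
    | add p q hp hq => simp only [add_tmul, map_add, hp, hq]
    | tmul v c =>
      apply beta_inj
      have := t3 (v ⊗ₜ (c ⊗ₜ (a ⊗ₜ (b ⊗ₜ 1))))
      rw [lTensor_tmul, lTensor_tmul, tm_tmul, tR_tmul, tR_tmul, outR] at this
      simpa using this
  · refine TensorProduct.ext_threefold fun w w' w'' => ?_
    induction w using TensorProduct.induction_on with
    | zero => simp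
    | add p q hp hq => simp only [add_tmul, map_add, hp, hq]
    | tmul v c =>
    induction w' using TensorProduct.induction_on with
    | zero => simp
    | add p q hp hq => simp only [add_tmul, tmul_add, map_add, hp, hq]
    | tmul v' c' =>
    induction w'' using TensorProduct.induction_on with
    | zero => simp
    | add p q hp hq => simp only [tmul_add, map_add, hp, hq]
    | tmul v'' c'' =>
      apply beta_inj
      have := t4 (v ⊗ₜ (c ⊗ₜ (v' ⊗ₜ (c' ⊗ₜ (v'' ⊗ₜ (c'' ⊗ₜ 1))))))
      rw [lTensor_tmul, lTensor_tmul, tS_tmul, tS_tmul, outRS, outS] at this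
      simpa using this
  · refine TensorProduct.ext_threefold fun w w' a => ?_
    induction w using TensorProduct.induction_on with
    | zero => simp
    | add p q hp hq => simp only [add_tmul, map_add, hp, hq]
    | tmul v c =>
    induction w' using TensorProduct.induction_on with
    | zero => simp
    | add p q hp hq => simp only [add_tmul, tmul_add, map_add, hp, hq]
    | tmul v' c' =>
      apply beta_inj
      have := t5 (v ⊗ₜ (c ⊗ₜ (v' ⊗ₜ (c' ⊗ₜ (a ⊗ₜ 1)))))
      rw [lTensor_tmul, lTensor_tmul, tR_tmul, tS_tmul, outRS, outR] at this
      simpa using this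
end TwoSidedCP
end
end

section
/- Let (A, V, C, R1, R2, R3, E) be two-sided crossed product data over a field k. Define R = (R1⊗id_C)∘(id_V⊗R3): (V⊗C)⊗A → A⊗(V⊗C) and σ: (V⊗C)⊗(V⊗C) → A⊗(V⊗C), σ((v⊗c)⊗(v'⊗c')) = E_A(v, v'_{R2})⊗(E_V(v, v'_{R2})⊗E_C(v, v'_{R2})c_{R2}c'). Then the cocycle-type condition (brz4) holds: (μ_A⊗id_{V⊗C})∘(id_A⊗σ)∘(R⊗id_{V⊗C})∘(id_{V⊗C}⊗σ) = (μ_A⊗id_{V⊗C})∘(id_A⊗σ)∘(σ⊗id_{V⊗C}). -/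
open TensorProduct LinearMap

set_option maxHeartbeats 1000000
set_option synthInstance.maxHeartbeats 400000

noncomputable section

namespace TwoSidedCP

variable (k : Type*) [Field k]

section Helpers
variable (A V C : Type*) [Ring A] [Algebra k A] [AddCommGroup V] [Module k V]
  [Ring C] [Algebra k C]

/-- Right multiplication by `g` on the `C`-factor, followed by reassociation. -/
def hRM (g : C) : (A ⊗[k] V) ⊗[k] C →ₗ[k] A ⊗[k] (V ⊗[k] C) :=
  α k A V C ∘ₗ lTensor (A ⊗[k] V) (LinearMap.mulRight k g)

/-- The left side of `eq6`, before inserting `E`. -/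
def hL6 (R1 : V ⊗[k] A →ₗ[k] A ⊗[k] V) (E : V ⊗[k] V →ₗ[k] (A ⊗[k] V) ⊗[k] C) :
    V ⊗[k] ((A ⊗[k] V) ⊗[k] C) →ₗ[k] (A ⊗[k] V) ⊗[k] C :=
  tsTail k A V C ∘ₗ rTensor C (lTensor A E) ∘ₗ rTensor C (α k A V V)
    ∘ₗ rTensor C (rTensor V R1) ∘ₗ rTensor C (α' k V A V) ∘ₗ α' k V (A ⊗[k] V) C

/-- The right side of `eq6`, before inserting `E`. -/
def hR6 (R2 : C ⊗[k] V →ₗ[k] V ⊗[k] C) (E : V ⊗[k] V →ₗ[k] (A ⊗[k] V) ⊗[k] C) :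
    ((A ⊗[k] V) ⊗[k] C) ⊗[k] V →ₗ[k] (A ⊗[k] V) ⊗[k] C :=
  tsTail k A V C ∘ₗ rTensor C (lTensor A E) ∘ₗ rTensor C (α k A V V)
    ∘ₗ α' k (A ⊗[k] V) V C ∘ₗ lTensor (A ⊗[k] V) R2 ∘ₗ α k (A ⊗[k] V) C V

/-- The right side of `eq5`, before inserting `E`. -/
def hP5 (R2 : C ⊗[k] V →ₗ[k] V ⊗[k] C) (R3 : C ⊗[k] A →ₗ[k] A ⊗[k] C) :
    C ⊗[k] ((A ⊗[k] V) ⊗[k] C) →ₗ[k] (A ⊗[k] V) ⊗[k] C :=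
  mulXC k (A ⊗[k] V) C ∘ₗ rTensor C (α' k A V C) ∘ₗ rTensor C (lTensor A R2)
    ∘ₗ rTensor C (α k A C V) ∘ₗ rTensor C (rTensor V R3) ∘ₗ rTensor C (α' k C A V)
    ∘ₗ α' k C (A ⊗[k] V) C

/-- `w ⊗ f ↦ w_{R2} ⊗ c_{R2} f`. -/
def hM (R2 : C ⊗[k] V →ₗ[k] V ⊗[k] C) : C ⊗[k] (V ⊗[k] C) →ₗ[k] V ⊗[k] C :=
  lTensor V (mul' k C) ∘ₗ α k V C C ∘ₗ rTensor C R2 ∘ₗ α' k C V C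

/-- The common outer map of both sides of (brz4). -/
def hOut (R2 : C ⊗[k] V →ₗ[k] V ⊗[k] C) (E : V ⊗[k] V →ₗ[k] (A ⊗[k] V) ⊗[k] C) :
    (A ⊗[k] (V ⊗[k] C)) ⊗[k] (V ⊗[k] C) →ₗ[k] A ⊗[k] (V ⊗[k] C) :=
  rTensor (V ⊗[k] C) (mul' k A) ∘ₗ α' k A A (V ⊗[k] C)
        ∘ₗ lTensor A (tsSigma k A V C R2 E) ∘ₗ α k A (V ⊗[k] C) (V ⊗[k] C)

variable {k A V C}

lemma hM_mul {R2 : C ⊗[k] V →ₗ[k] V ⊗[k] C} (eq2 : R2 ∘ₗ rTensor V (mul' k C)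
      = lTensor V (mul' k C) ∘ₗ α k V C C ∘ₗ rTensor C R2 ∘ₗ α' k C V C ∘ₗ lTensor C R2
        ∘ₗ α k C C V) (c d : C) (v : V) :
    R2 ((c * d) ⊗ₜ v) = hM k V C R2 (c ⊗ₜ R2 (d ⊗ₜ v)) := by
  simpa using! LinearMap.congr_fun eq2 ((c ⊗ₜ d) ⊗ₜ v)

lemma h_sigma (R2 : C ⊗[k] V →ₗ[k] V ⊗[k] C) (E : V ⊗[k] V →ₗ[k] (A ⊗[k] V) ⊗[k] C)
    (v v' : V) (c c' : C) :
    tsSigma k A V C R2 E ((v ⊗ₜ c) ⊗ₜ (v' ⊗ₜ c'))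
      = α k A V C (mulXC k (A ⊗[k] V) C (rTensor C E (α' k V V C
          (v ⊗ₜ lTensor V (LinearMap.mulRight k c') (R2 (c ⊗ₜ v')))))) := by
  simp only [tsSigma, LinearMap.comp_apply, LinearEquiv.coe_coe, assoc_tmul, assoc_symm_tmul,
    lTensor_tmul, rTensor_tmul]
  generalize R2 (c ⊗ₜ v') = y
  induction y using TensorProduct.induction_on with
  | zero => simp only [map_zero, tmul_zero, zero_tmul]
  | add x y hx hy => simp only [map_add, tmul_add, add_tmul, hx, hy]
  | tmul w f => simp

lemma h_lem1 (R1 : V ⊗[k] A →ₗ[k] A ⊗[k] V) (R2 : C ⊗[k] V →ₗ[k] V ⊗[k] C)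
    (R3 : C ⊗[k] A →ₗ[k] A ⊗[k] C) (E : V ⊗[k] V →ₗ[k] (A ⊗[k] V) ⊗[k] C)
    (v : V) (c g : C) (x : (A ⊗[k] V) ⊗[k] C) :
    hOut k A V C R2 E (rTensor (V ⊗[k] C) (tsR k A V C R1 R3) (α' k (V ⊗[k] C) A (V ⊗[k] C)
      ((v ⊗ₜ c) ⊗ₜ (α k A V C (mulXC k (A ⊗[k] V) C (x ⊗ₜ g))))))
    = hRM k A V C g (hL6 k A V C R1 E (v ⊗ₜ hP5 k A V C R2 R3 (c ⊗ₜ x))) := by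
  induction x using TensorProduct.induction_on with
  | zero => simp only [map_zero, tmul_zero, zero_tmul]
  | add x y hx hy => simp only [map_add, tmul_add, add_tmul, hx, hy]
  | tmul y d =>
  induction y using TensorProduct.induction_on with
  | zero => simp only [map_zero, tmul_zero, zero_tmul]
  | add x y hx hy => simp only [map_add, tmul_add, add_tmul, hx, hy]
  | tmul a u =>
  simp only [hOut, tsR, hP5, mulXC, LinearMap.comp_apply, LinearEquiv.coe_coe, assoc_tmul,
    assoc_symm_tmul, lTensor_tmul, rTensor_tmul, mul'_apply]
  generalize R3 (c ⊗ₜ a) = z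
  induction z using TensorProduct.induction_on with
  | zero => simp only [map_zero, tmul_zero, zero_tmul]
  | add x y hx hy => simp only [map_add, tmul_add, add_tmul, hx, hy]
  | tmul a1 c1 =>
  simp only [hL6, LinearMap.comp_apply, LinearEquiv.coe_coe, assoc_tmul,
    assoc_symm_tmul, lTensor_tmul, rTensor_tmul, mul'_apply]
  generalize hq : R2 (c1 ⊗ₜ u) = q
  have key : ∀ (p : A ⊗[k] V),
      rTensor (V ⊗[k] C) (mul' k A) (α' k A A (V ⊗[k] C) (lTensor A (tsSigma k A V C R2 E)
        (α k A (V ⊗[k] C) (V ⊗[k] C) (α k A V C (p ⊗ₜ c1) ⊗ₜ (u ⊗ₜ (d * g))))))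
      = rTensor (V ⊗[k] C) (mul' k A) (α' k A A (V ⊗[k] C) (lTensor A (
         α k A V C ∘ₗ mulXC k (A ⊗[k] V) C ∘ₗ rTensor C E ∘ₗ α' k V V C)
        (α k A V (V ⊗[k] C) (p ⊗ₜ lTensor V (LinearMap.mulRight k (d * g)) q)))) := by
    intro p
    induction p using TensorProduct.induction_on with
    | zero => simp only [map_zero, tmul_zero, zero_tmul]
    | add x y hx hy => simp only [map_add, tmul_add, add_tmul, hx, hy]
    | tmul a2 v2 =>
    simp only [LinearMap.comp_apply, LinearEquiv.coe_coe, assoc_tmul,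
      assoc_symm_tmul, lTensor_tmul, rTensor_tmul, mul'_apply, h_sigma, hq]
  have key' := key (R1 (v ⊗ₜ a1))
  simp only [LinearEquiv.coe_coe] at key'
  rw [key']
  clear key key' hq
  induction q using TensorProduct.induction_on with
  | zero => simp only [map_zero, tmul_zero, zero_tmul]
  | add x y hx hy => simp only [map_add, tmul_add, add_tmul, hx, hy]
  | tmul u2 c2 =>
  simp only [LinearMap.comp_apply, LinearEquiv.coe_coe, assoc_tmul,
    assoc_symm_tmul, lTensor_tmul, rTensor_tmul, mul'_apply, LinearMap.mulRight_apply]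
  generalize R1 (v ⊗ₜ a1) = p
  induction p using TensorProduct.induction_on with
  | zero => simp only [map_zero, tmul_zero, zero_tmul]
  | add x y hx hy => simp only [map_add, tmul_add, add_tmul, hx, hy]
  | tmul a2 v2 =>
  simp only [LinearMap.comp_apply, LinearEquiv.coe_coe, assoc_tmul,
    assoc_symm_tmul, lTensor_tmul, rTensor_tmul, mul'_apply, LinearMap.mulRight_apply]
  generalize E (v2 ⊗ₜ u2) = r
  induction r using TensorProduct.induction_on with
  | zero => simp only [map_zero, tmul_zero, zero_tmul]
  | add x y hx hy => simp only [map_add, tmul_add, add_tmul, hx, hy]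
  | tmul r c3 =>
  induction r using TensorProduct.induction_on with
  | zero => simp only [map_zero, tmul_zero, zero_tmul]
  | add x y hx hy => simp only [map_add, tmul_add, add_tmul, hx, hy]
  | tmul a3 v3 =>
  simp [hRM, tsTail, mulXC, mulAV, mul_assoc]

lemma h_lem2 (R1 : V ⊗[k] A →ₗ[k] A ⊗[k] V) (E : V ⊗[k] V →ₗ[k] (A ⊗[k] V) ⊗[k] C)
    (v : V) (c g : C) (x : (A ⊗[k] V) ⊗[k] C) :
    hRM k A V C g (hL6 k A V C R1 E (v ⊗ₜ mulXC k (A ⊗[k] V) C (x ⊗ₜ c)))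
      = hRM k A V C (c * g) (hL6 k A V C R1 E (v ⊗ₜ x)) := by
  induction x using TensorProduct.induction_on with
  | zero => simp only [map_zero, tmul_zero, zero_tmul]
  | add x y hx hy => simp only [map_add, tmul_add, add_tmul, hx, hy]
  | tmul y d =>
  induction y using TensorProduct.induction_on with
  | zero => simp only [map_zero, tmul_zero, zero_tmul]
  | add x y hx hy => simp only [map_add, tmul_add, add_tmul, hx, hy]
  | tmul a u =>
  simp only [hL6, mulXC, LinearMap.comp_apply, LinearEquiv.coe_coe, assoc_tmul,
    assoc_symm_tmul, lTensor_tmul, rTensor_tmul, mul'_apply]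
  generalize lTensor A E (TensorProduct.assoc k A V V (R1 (v ⊗ₜ a) ⊗ₜ u)) = r
  induction r using TensorProduct.induction_on with
  | zero => simp only [map_zero, tmul_zero, zero_tmul]
  | add x y hx hy => simp only [map_add, tmul_add, add_tmul, hx, hy]
  | tmul a1 r =>
  induction r using TensorProduct.induction_on with
  | zero => simp only [map_zero, tmul_zero, zero_tmul]
  | add x y hx hy => simp only [map_add, tmul_add, add_tmul, hx, hy]
  | tmul r c3 =>
  induction r using TensorProduct.induction_on with
  | zero => simp only [map_zero, tmul_zero, zero_tmul]
  | add x y hx hy => simp only [map_add, tmul_add, add_tmul, hx, hy]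
  | tmul a3 v3 =>
  simp [hRM, tsTail, mulXC, mulAV, mul_assoc]

/-- `w ⊗ f ↦ hR6 (x ⊗ w) · f g`. -/
def hS (R2 : C ⊗[k] V →ₗ[k] V ⊗[k] C) (E : V ⊗[k] V →ₗ[k] (A ⊗[k] V) ⊗[k] C) (g : C) :
    ((A ⊗[k] V) ⊗[k] C) ⊗[k] (V ⊗[k] C) →ₗ[k] A ⊗[k] (V ⊗[k] C) :=
  hRM k A V C g ∘ₗ mulXC k (A ⊗[k] V) C ∘ₗ rTensor C (hR6 k A V C R2 E)
    ∘ₗ α' k ((A ⊗[k] V) ⊗[k] C) V C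

lemma hS_tmul (R2 : C ⊗[k] V →ₗ[k] V ⊗[k] C) (E : V ⊗[k] V →ₗ[k] (A ⊗[k] V) ⊗[k] C) (g : C)
    (x : (A ⊗[k] V) ⊗[k] C) (w : V) (f : C) :
    hS R2 E g (x ⊗ₜ (w ⊗ₜ f)) = hRM k A V C (f * g) (hR6 k A V C R2 E (x ⊗ₜ w)) := by
  simp only [hS, LinearMap.comp_apply, LinearEquiv.coe_coe, assoc_symm_tmul, rTensor_tmul]
  generalize hR6 k A V C R2 E (x ⊗ₜ w) = r
  induction r using TensorProduct.induction_on with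
  | zero => simp only [map_zero, tmul_zero, zero_tmul]
  | add x y hx hy => simp only [map_add, tmul_add, add_tmul, hx, hy]
  | tmul r c3 => simp [hRM, mulXC, mul_assoc]

lemma h_lem4 {R2 : C ⊗[k] V →ₗ[k] V ⊗[k] C} (eq2 : R2 ∘ₗ rTensor V (mul' k C)
      = lTensor V (mul' k C) ∘ₗ α k V C C ∘ₗ rTensor C R2 ∘ₗ α' k C V C ∘ₗ lTensor C R2
        ∘ₗ α k C C V) (E : V ⊗[k] V →ₗ[k] (A ⊗[k] V) ⊗[k] C)
    (x : (A ⊗[k] V) ⊗[k] C) (h : C) (v : V) (g : C) :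
    hOut k A V C R2 E (α k A V C (mulXC k (A ⊗[k] V) C (x ⊗ₜ h)) ⊗ₜ (v ⊗ₜ g))
      = hS R2 E g (x ⊗ₜ R2 (h ⊗ₜ v)) := by
  induction x using TensorProduct.induction_on with
  | zero => simp only [map_zero, tmul_zero, zero_tmul]
  | add x y hx hy => simp only [map_add, tmul_add, add_tmul, hx, hy]
  | tmul y q =>
  induction y using TensorProduct.induction_on with
  | zero => simp only [map_zero, tmul_zero, zero_tmul]
  | add x y hx hy => simp only [map_add, tmul_add, add_tmul, hx, hy]
  | tmul b p =>
  simp only [hOut, mulXC, LinearMap.comp_apply, LinearEquiv.coe_coe, assoc_tmul,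
    assoc_symm_tmul, lTensor_tmul, rTensor_tmul, mul'_apply, h_sigma, hM_mul eq2]
  generalize R2 (h ⊗ₜ v) = y
  induction y using TensorProduct.induction_on with
  | zero => simp only [map_zero, tmul_zero, zero_tmul]
  | add x y hx hy => simp only [map_add, tmul_add, add_tmul, hx, hy]
  | tmul w f =>
  rw [hS_tmul]
  simp only [hM, hR6, LinearMap.comp_apply, LinearEquiv.coe_coe, assoc_tmul,
    assoc_symm_tmul, lTensor_tmul, rTensor_tmul, mul'_apply]
  generalize R2 (q ⊗ₜ w) = y
  induction y using TensorProduct.induction_on with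
  | zero => simp only [map_zero, tmul_zero, zero_tmul]
  | add x y hx hy => simp only [map_add, tmul_add, add_tmul, hx, hy]
  | tmul w3 q3 =>
  simp only [LinearMap.comp_apply, LinearEquiv.coe_coe, assoc_tmul,
    assoc_symm_tmul, lTensor_tmul, rTensor_tmul, mul'_apply, LinearMap.mulRight_apply]
  generalize E (p ⊗ₜ w3) = r
  induction r using TensorProduct.induction_on with
  | zero => simp only [map_zero, tmul_zero, zero_tmul]
  | add x y hx hy => simp only [map_add, tmul_add, add_tmul, hx, hy]
  | tmul r c3 =>
  induction r using TensorProduct.induction_on with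
  | zero => simp only [map_zero, tmul_zero, zero_tmul]
  | add x y hx hy => simp only [map_add, tmul_add, add_tmul, hx, hy]
  | tmul a3 v3 =>
  simp [hRM, tsTail, mulXC, mulAV, mul_assoc]

lemma h_main {e : V}
    {R1 : V ⊗[k] A →ₗ[k] A ⊗[k] V} {R2 : C ⊗[k] V →ₗ[k] V ⊗[k] C}
    {R3 : C ⊗[k] A →ₗ[k] A ⊗[k] C} {E : V ⊗[k] V →ₗ[k] (A ⊗[k] V) ⊗[k] C}
    (h : IsTwoSidedData k A V C e R1 R2 R3 E) (v v' v'' : V) (c c' c'' : C) :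
    hOut k A V C R2 E (rTensor (V ⊗[k] C) (tsR k A V C R1 R3) (α' k (V ⊗[k] C) A (V ⊗[k] C)
      ((v ⊗ₜ c) ⊗ₜ (tsSigma k A V C R2 E ((v' ⊗ₜ c') ⊗ₜ (v'' ⊗ₜ c''))))))
    = hOut k A V C R2 E (tsSigma k A V C R2 E ((v ⊗ₜ c) ⊗ₜ (v' ⊗ₜ c')) ⊗ₜ (v'' ⊗ₜ c'')) := by
  have e5 : ∀ w, hP5 k A V C R2 R3 (c ⊗ₜ E (v' ⊗ₜ w)) = mulXC k (A ⊗[k] V) C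
      (rTensor C E (α' k V V C (lTensor V R2 (α k V C V (R2 (c ⊗ₜ v') ⊗ₜ w))))) := fun w =>
    (LinearMap.congr_fun h.eq5 ((c ⊗ₜ v') ⊗ₜ w)).symm
  have e6 : ∀ v1 w, hL6 k A V C R1 E (v ⊗ₜ E (v1 ⊗ₜ w)) = hR6 k A V C R2 E (E (v ⊗ₜ v1) ⊗ₜ w) :=
    fun v1 w => LinearMap.congr_fun h.eq6 ((v ⊗ₜ v1) ⊗ₜ w)
  rw [h_sigma, h_sigma]
  trans hS R2 E c'' (TensorProduct.map (E ∘ₗ TensorProduct.mk k V V v) (hM k V C R2)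
    (α k V C (V ⊗[k] C) (R2 (c ⊗ₜ v') ⊗ₜ R2 (c' ⊗ₜ v''))))
  · generalize R2 (c' ⊗ₜ v'') = y
    induction y using TensorProduct.induction_on with
    | zero => simp only [map_zero, tmul_zero, zero_tmul]
    | add x y hx hy => simp only [map_add, tmul_add, add_tmul, hx, hy]
    | tmul w f =>
    simp only [LinearEquiv.coe_coe, assoc_symm_tmul, lTensor_tmul, rTensor_tmul,
      LinearMap.mulRight_apply]
    have l1 := h_lem1 R1 R2 R3 E v c (f * c'') (E (v' ⊗ₜ w))
    simp only [LinearEquiv.coe_coe] at l1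
    rw [l1, e5]
    generalize R2 (c ⊗ₜ v') = z
    induction z using TensorProduct.induction_on with
    | zero => simp only [map_zero, tmul_zero, zero_tmul]
    | add x y hx hy => simp only [map_add, tmul_add, add_tmul, hx, hy]
    | tmul v1 c1 =>
    simp only [hM, LinearMap.comp_apply, LinearEquiv.coe_coe, assoc_tmul, assoc_symm_tmul,
      lTensor_tmul, rTensor_tmul, TensorProduct.map_tmul, TensorProduct.mk_apply]
    generalize R2 (c1 ⊗ₜ w) = z
    induction z using TensorProduct.induction_on with
    | zero => simp only [map_zero, tmul_zero, zero_tmul]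
    | add x y hx hy => simp only [map_add, tmul_add, add_tmul, hx, hy]
    | tmul w2 c2 =>
    simp only [assoc_tmul, assoc_symm_tmul, lTensor_tmul, rTensor_tmul, mul'_apply,
      hS_tmul, h_lem2, e6, mul_assoc]
  · generalize R2 (c ⊗ₜ v') = z
    induction z using TensorProduct.induction_on with
    | zero => simp only [map_zero, tmul_zero, zero_tmul]
    | add x y hx hy => simp only [map_add, tmul_add, add_tmul, hx, hy]
    | tmul v1 c1 =>
    have l4 := h_lem4 h.eq2 E (E (v ⊗ₜ v1)) (c1 * c') v'' c''
    simp only [LinearEquiv.coe_coe] at l4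
    simp only [LinearMap.comp_apply, LinearEquiv.coe_coe, assoc_tmul, assoc_symm_tmul,
      lTensor_tmul, rTensor_tmul, TensorProduct.map_tmul, TensorProduct.mk_apply,
      LinearMap.mulRight_apply]
    rw [l4, hM_mul h.eq2]

end Helpers

/-- for two-sided crossed product data, the maps
`R = (R1 ⊗ id_C)∘(id_V ⊗ R3)` and `σ` satisfy the cocycle-type condition (brz4). -/
theorem tsSigma_satisfies_brz4
    (A V C : Type*) [Ring A] [Algebra k A] [AddCommGroup V] [Module k V]
    [Ring C] [Algebra k C] (e : V) (he : e ≠ 0)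
    (R1 : V ⊗[k] A →ₗ[k] A ⊗[k] V) (R2 : C ⊗[k] V →ₗ[k] V ⊗[k] C)
    (R3 : C ⊗[k] A →ₗ[k] A ⊗[k] C) (E : V ⊗[k] V →ₗ[k] (A ⊗[k] V) ⊗[k] C)
    (h : IsTwoSidedData k A V C e R1 R2 R3 E) :
    rTensor (V ⊗[k] C) (mul' k A) ∘ₗ α' k A A (V ⊗[k] C)
        ∘ₗ lTensor A (tsSigma k A V C R2 E) ∘ₗ α k A (V ⊗[k] C) (V ⊗[k] C)
        ∘ₗ rTensor (V ⊗[k] C) (tsR k A V C R1 R3) ∘ₗ α' k (V ⊗[k] C) A (V ⊗[k] C)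
        ∘ₗ lTensor (V ⊗[k] C) (tsSigma k A V C R2 E)
        ∘ₗ α k (V ⊗[k] C) (V ⊗[k] C) (V ⊗[k] C)
      = rTensor (V ⊗[k] C) (mul' k A) ∘ₗ α' k A A (V ⊗[k] C)
        ∘ₗ lTensor A (tsSigma k A V C R2 E) ∘ₗ α k A (V ⊗[k] C) (V ⊗[k] C)
        ∘ₗ rTensor (V ⊗[k] C) (tsSigma k A V C R2 E) := by
  apply TensorProduct.ext_threefold
  intro x y z
  change hOut k A V C R2 E (rTensor (V ⊗[k] C) (tsR k A V C R1 R3) (α' k (V ⊗[k] C) A (V ⊗[k] C)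
      (x ⊗ₜ (tsSigma k A V C R2 E (y ⊗ₜ z)))))
    = hOut k A V C R2 E (tsSigma k A V C R2 E (x ⊗ₜ y) ⊗ₜ z)
  induction x using TensorProduct.induction_on with
  | zero => simp only [map_zero, tmul_zero, zero_tmul]
  | add x y hx hy => simp only [map_add, tmul_add, add_tmul, hx, hy]
  | tmul v c =>
  induction y using TensorProduct.induction_on with
  | zero => simp only [map_zero, tmul_zero, zero_tmul]
  | add x y hx hy => simp only [map_add, tmul_add, add_tmul, hx, hy]
  | tmul v' c' =>
  induction z using TensorProduct.induction_on with
  | zero => simp only [map_zero, tmul_zero, zero_tmul]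
  | add x y hx hy => simp only [map_add, tmul_add, add_tmul, hx, hy]
  | tmul v'' c'' => exact h_main h v v' v'' c c' c''
end TwoSidedCP
end
end
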